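/- In the good-path setting, fix L > 1. For each n ∈ ℕ there exists r′_n > r_n such that for every r ∈ R with r > r′_n and every ζ^r ∈ B_L^r, there exists ζ ∈ B_L with sup_{t∈[0,L]} d[ζ^r(t), ζ(t)] ≤ ε_n and sup_{t∈[0,L]} |⟨χ, ζ^r(t)⟩ − ⟨χ, ζ(t)⟩| ≤ ε_n. -/

import Mathlib

open MeasureTheory Filter Set
noncomputable section
namespace PSQ

/-- ⟨g, ζ⟩ = ∫ g dζ -/
def pair (g : ℝ → ℝ) (ζ : Measure ℝ) : ℝ := ∫ x, g x ∂ζ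

/-- total mass ⟨1, ζ⟩ of a finite measure, as a real number -/
def mass (ζ : Measure ℝ) : ℝ := (ζ Set.univ).toReal

/-- truncated Dirac measure δ⁺ₓ -/
def dplus (x : ℝ) : Measure ℝ := if 0 < x then Measure.dirac x else 0

/-- positive part x⁺ -/
def pos (x : ℝ) : ℝ := max x 0

/-- the arrival counting process E(t) = sup{i : U i ≤ t} -/
def Ecount (U : ℕ → ℝ) (t : ℝ) : ℕ := sSup {i : ℕ | U i ≤ t}

/-- the standing hypotheses on the data of a pathwise processor sharing queue:
nondecreasing arrival times with `U 0 = 0`, `U 1 > 0`, `U i → ∞`, and strictly positive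
service times and initial service times. -/
def QueueHyps (U v : ℕ → ℝ) (Z0 : ℕ) (vt : ℕ → ℝ) : Prop :=
  U 0 = 0 ∧ Monotone U ∧ 0 < U 1 ∧ Tendsto U atTop atTop ∧
    (∀ i, 1 ≤ i → 0 < v i) ∧ (∀ j, 1 ≤ j → 0 < vt j)

/-- the defining equations of the state descriptor μ and the cumulative service per
job S:  `S t = ∫_0^t φ(⟨1, μ(s)⟩) ds` (recall `(0:ℝ)⁻¹ = 0` in Lean, matching φ(0)=0)
and `μ(t) = Σ_j δ⁺_{(ṽ_j - S(t))⁺} + Σ_{i ≤ E(t)} δ⁺_{(v_i - S(t) + S(U_i))⁺}`. -/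
def StateEqns (U v : ℕ → ℝ) (Z0 : ℕ) (vt : ℕ → ℝ)
    (μ : ℝ → Measure ℝ) (S : ℝ → ℝ) : Prop :=
  ∀ t, 0 ≤ t →
    (S t = ∫ s in (0:ℝ)..t, (mass (μ s))⁻¹) ∧
    μ t = (∑ j ∈ Finset.range Z0, dplus (pos (vt (j+1) - S t)))
        + ∑ i ∈ Finset.range (Ecount U t), dplus (pos (v (i+1) - S t + S (U (i+1))))

/-- fluid scaled state descriptor μ̄^r(t) = r⁻¹ μ(rt) -/
def fmu (μ : ℝ → Measure ℝ) (r t : ℝ) : Measure ℝ := ENNReal.ofReal (1/r) • μ (r*t)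

/-- fluid scaled arrival process Ē^r(t) = r⁻¹ E(rt) -/
def fE (U : ℕ → ℝ) (r t : ℝ) : ℝ := (Ecount U (r*t) : ℝ) / r

/-- fluid scaled cumulative service S̄^r_{t,t'} = S(r t') - S(r t) -/
def fS (S : ℝ → ℝ) (r t t' : ℝ) : ℝ := S (r*t') - S (r*t)

end PSQ
end

namespace PSQ

/-- The constraints tying together the constants of the good-path properties:
`ε ∈ (0,1)`, `l, p, κ, γ > 0`, `M > 1`, `l < ε/(32α)`, `κ < l/(2M)`,
`γ < (κε/4) ∧ (l/4)`. -/
def GoodConsts (α ε l p κ γ M : ℝ) : Prop :=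
  ε ∈ Set.Ioo (0:ℝ) 1 ∧ 0 < l ∧ 0 < p ∧ 0 < κ ∧ 0 < γ ∧ 1 < M ∧
    l < ε/(32*α) ∧ κ < l/(2*M) ∧ γ < min (κ*ε/4) (l/4)

/-- A processor sharing path satisfies the level-(ε, l, κ, γ, M) good-path properties
(for r, T, L), with `N = ⌈64M²/(κε²)⌉ + 1`. -/
def GoodPath (U v : ℕ → ℝ) (μ : ℝ → Measure ℝ) (ν : Measure ℝ)
    (T L r ε l p κ γ M : ℝ) : Prop :=
  ∀ m : ℕ, m ≤ ⌊r * T⌋₊ →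
    (∀ t ∈ Set.Icc (0:ℝ) L, fE U r ((m:ℝ) + t + l) - fE U r ((m:ℝ) + t) ≤ ε/16) ∧
    (∀ t ∈ Set.Icc (0:ℝ) L,
      max (max (mass (fmu μ r ((m:ℝ)+t))) (pair id (fmu μ r ((m:ℝ)+t))))
        (pair (fun x => x ^ ((1:ℝ)+p)) (fmu μ r ((m:ℝ)+t))) ≤ M) ∧
    (∀ x : ℝ, 0 ≤ x → ((fmu μ r 0) (Set.Icc x (x+κ))).toReal ≤ ε/4) ∧
    (∀ t ∈ Set.Icc (0:ℝ) L,
      |pair id (fmu μ r ((m:ℝ)+t)) - pair id (fmu μ r (m:ℝ))| ≤ γ/4) ∧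
    (∀ t ∈ Set.Icc (0:ℝ) L, ∀ k : ℕ, k ≤ ⌈64*M^2/(κ*ε^2)⌉₊ + 1 →
      (1/r) * (∑ i ∈ Finset.Ioc (Ecount U (r*((m:ℝ)+t))) (Ecount U (r*((m:ℝ)+t+l))),
          if (k:ℝ)*κ ≤ v i ∧ v i < ((k:ℝ)+1)*κ then (1:ℝ) else 0)
        ≤ (ε/8) * (ν (Set.Ico (((k:ℝ)-1/2)*κ) (((k:ℝ)+3/2)*κ))).toReal)

end PSQ

namespace PSQ

/-- the metric d on finite measures built from the families (g_k), (h_k)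
(with 0-based indexing, so `g k` plays the role of the paper's `g_{k+1}`). -/
noncomputable def dmet (g h : ℕ → ℝ → ℝ) (ζ₁ ζ₂ : Measure ℝ) : ℝ :=
  (∑' k : ℕ, (2:ℝ)⁻¹^(k+1) * min |pair (g k) ζ₁ - pair (g k) ζ₂| 1)
    + ⨆ k : ℕ, |pair (h k) ζ₁ - pair (h k) ζ₂|

/-- the hypotheses on the families (g_k), (h_k) defining the metric d (0-based
indexing: `h k` vanishes on [0,k] and equals 1 on [k+1,∞), i.e. it is the paper's
`h_{k+1}`); the family (g_k) is convergence determining for weak convergence of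
finite Borel measures on ℝ₊. -/
def MetricFamilies (g h : ℕ → ℝ → ℝ) : Prop :=
  (∀ k, (∀ x, 0 ≤ g k x ∧ g k x ≤ 1) ∧ ContDiff ℝ 1 (g k) ∧ ∃ C, ∀ x, |deriv (g k) x| ≤ C) ∧
  (∀ k, (∀ x, 0 ≤ h k x ∧ h k x ≤ 1) ∧ ContDiff ℝ 1 (h k) ∧
    (∀ x ∈ Set.Icc (0:ℝ) (k:ℝ), h k x = 0) ∧ (∀ x, (k:ℝ)+1 ≤ x → h k x = 1) ∧
    (∀ x, |deriv (h k) x| ≤ 2)) ∧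
  (∀ (ζs : ℕ → Measure ℝ) (ζ : Measure ℝ),
    (∀ j, IsFiniteMeasure (ζs j)) → IsFiniteMeasure ζ →
    (∀ j, ζs j (Set.Iio 0) = 0) → ζ (Set.Iio 0) = 0 →
    (∀ k, Tendsto (fun j => pair (g k) (ζs j)) atTop (nhds (pair (g k) ζ))) →
    ∀ f : ℝ → ℝ, Continuous f → (∃ C, ∀ x, |f x| ≤ C) →
      Tendsto (fun j => pair f (ζs j)) atTop (nhds (pair f ζ)))

end PSQ

namespace PSQ

/-- the excess lifetime distribution ν_e associated with ν:
it has density y ↦ β·ν((y,∞)) on [0,∞) with β = (∫x dν)⁻¹, so that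
ν_e([0,x]) = β ∫_0^x ν((y,∞)) dy. -/
noncomputable def nue (ν : Measure ℝ) : Measure ℝ :=
  (volume.restrict (Set.Ici (0:ℝ))).withDensity
    fun y => ν (Set.Ioi y) * (ENNReal.ofReal (∫ x, x ∂ν))⁻¹

/-- the lifting map Δ: w ↦ (w/⟨χ,νe⟩)·νe -/
noncomputable def Delta (νe : Measure ℝ) (w : ℝ) : Measure ℝ :=
  ENNReal.ofReal (w / ∫ x, x ∂νe) • νe

/-- sums of g(v_i) over arrivals i with s < U_i-index ≤ t,
i.e. Σ_{i = E(s)+1}^{E(t)} g(v_i). -/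
noncomputable def arrSum (U w : ℕ → ℝ) (g : ℝ → ℝ) (s t : ℝ) : ℝ :=
  ∑ i ∈ Finset.Ioc (Ecount U s) (Ecount U t), g (w i)

/-- weak continuity of a measure-valued path on a set -/
def WeaklyContinuousOn (ζ : ℝ → Measure ℝ) (s : Set ℝ) : Prop :=
  ∀ f : ℝ → ℝ, Continuous f → (∃ C, ∀ x, |f x| ≤ C) →
    ContinuousOn (fun t => pair f (ζ t)) s

/-- fluid model solution on [0,L] for critical data (α, ν) -/
def IsFluidSol (α : ℝ) (ν : Measure ℝ) (L : ℝ) (ζ : ℝ → Measure ℝ) : Prop :=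
  (∀ t ∈ Set.Icc (0:ℝ) L, IsFiniteMeasure (ζ t) ∧ ζ t (Set.Iio 0) = 0 ∧ ζ t {0} = 0) ∧
  WeaklyContinuousOn ζ (Set.Icc 0 L) ∧
  ((ζ 0 = 0 ∧ ∀ t ∈ Set.Icc (0:ℝ) L, ζ t = 0) ∨
   ((∀ t ∈ Set.Icc (0:ℝ) L, ζ t ≠ 0) ∧
    ∀ t ∈ Set.Icc (0:ℝ) L, ∀ gf : ℝ → ℝ, ContDiff ℝ 1 gf →
      (∃ C, ∀ x, |gf x| ≤ C ∧ |deriv gf x| ≤ C) → gf 0 = 0 → deriv gf 0 = 0 →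
      pair gf (ζ t) = pair gf (ζ 0)
        - (∫ s in (0:ℝ)..t, pair (deriv gf) (ζ s) / mass (ζ s)) + α * t * pair gf ν))

/-- The good-path setting: all the fixed data (heavy traffic sequence R, threshold
sequences ε_n, l_n, κ_n, γ_n, constants p, M, a dense family V of test functions, the
families g, h defining the metric d, the sequence r_n) together with their standing
hypotheses. -/
structure Setting where
  α : ℝ
  ν : Measure ℝ
  T : ℝ
  R : ℕ → ℝ
  εseq : ℕ → ℝ
  lseq : ℕ → ℝ
  κseq : ℕ → ℝ
  γseq : ℕ → ℝ
  p : ℝ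
  M : ℝ
  V : ℕ → ℝ → ℝ
  gmet : ℕ → ℝ → ℝ
  hmet : ℕ → ℝ → ℝ
  rseq : ℕ → ℝ
  hα : 0 < α
  hν : IsProbabilityMeasure ν
  hν0 : ν {0} = 0
  hνsupp : ν (Set.Iio 0) = 0
  hνint : Integrable (fun x => x) ν
  hcrit : α * ∫ x, x ∂ν = 1
  hT : 1 < T
  hR : ∀ n, 0 < R n
  hRmono : StrictMono R
  hRtop : Tendsto R atTop atTop
  hε : ∀ n, εseq n ∈ Set.Ioo (0:ℝ) 1
  hεanti : StrictAnti εseq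
  hεlim : Tendsto εseq atTop (nhds 0)
  hp : 0 < p
  hM : 1 < M
  hl : ∀ n, 0 < lseq n
  hκ : ∀ n, 0 < κseq n
  hγ : ∀ n, 0 < γseq n
  hlε : ∀ n, lseq n < εseq n/(32*α)
  hκl : ∀ n, κseq n < lseq n/(2*M)
  hγc : ∀ n, γseq n < min (κseq n * εseq n/4) (lseq n/4)
  hVsupp : ∀ k, HasCompactSupport (V k)
  hVdiff : ∀ k, ContDiff ℝ 1 (V k)
  hV0 : ∀ k, V k 0 = 0 ∧ deriv (V k) 0 = 0
  hVdense : ∀ g : ℝ → ℝ, HasCompactSupport g → ContDiff ℝ 1 g →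
    g 0 = 0 → deriv g 0 = 0 →
    ∃ φ : ℕ → ℕ, (∃ C, ∀ j x, |V (φ j) x| ≤ C ∧ |deriv (V (φ j)) x| ≤ C) ∧
      (∀ x, Tendsto (fun j => V (φ j) x) atTop (nhds (g x))) ∧
      (∀ x, Tendsto (fun j => deriv (V (φ j)) x) atTop (nhds (deriv g x)))
  hmetfam : MetricFamilies gmet hmet
  hrpos : ∀ n, 0 < rseq n
  hrmono : StrictMono rseq
  hrtop : Tendsto rseq atTop atTop

/-- the excess lifetime distribution of the setting -/
noncomputable def Setting.nuE (S : Setting) : Measure ℝ := nue S.ν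

/-- the index n(r) -/
noncomputable def Setting.nIdx (S : Setting) (r : ℝ) : ℕ := sSup {n : ℕ | S.rseq n < r}

/-- membership in the invariant manifold M_ν -/
def Setting.onManifold (S : Setting) (ξ : Measure ℝ) : Prop :=
  ∃ c : ℝ, 0 ≤ c ∧ ξ = ENNReal.ofReal c • S.nuE

/-- the distance of a measure-valued path on [0,L] to the good paths B_L^r :
ζ ∈ B_L^r iff ζ agrees on [0,L] with some shifted fluid scaled state descriptor
μ̄^{r,m}, 0 ≤ m ≤ ⌊rT⌋, of a processor-sharing path satisfying, for all n' ≤ n(r),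
the level-(ε_{n'}, l_{n'}, κ_{n'}, γ_{n'}, M) good-path properties, the law of large
numbers bounds for the test family V, and whose initial measure is ε_{n'}-close to
the invariant manifold. -/
def Setting.memBLr (S : Setting) (L r : ℝ) (ζ : ℝ → Measure ℝ) : Prop :=
  ∃ (U v : ℕ → ℝ) (Z0 : ℕ) (vt : ℕ → ℝ) (μ : ℝ → Measure ℝ) (Sf : ℝ → ℝ) (m : ℕ),
    QueueHyps U v Z0 vt ∧ StateEqns U v Z0 vt μ Sf ∧ m ≤ ⌊r * S.T⌋₊ ∧
    (∀ t ∈ Set.Icc (0:ℝ) L, ζ t = fmu μ r ((m:ℝ)+t)) ∧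
    ∀ n' : ℕ, n' ≤ S.nIdx r →
      GoodPath U v μ S.ν S.T L r (S.εseq n') (S.lseq n') S.p (S.κseq n') (S.γseq n') S.M ∧
      (∀ k : ℕ, k ≤ n' → ∀ j : ℕ, 1 ≤ j → j ≤ ⌊L / S.lseq n'⌋₊ → ∀ m' : ℕ, m' ≤ ⌊r*S.T⌋₊ →
        |(1/r) * arrSum U v (S.V k) (r*(m':ℝ)) (r*((m':ℝ) + (j:ℝ) * S.lseq n'))
          - S.α * (j:ℝ) * S.lseq n' * pair (S.V k) S.ν| ≤ S.εseq n') ∧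
      (∃ ξ : Measure ℝ, S.onManifold ξ ∧
        max (dmet S.gmet S.hmet (fmu μ r 0) ξ) |pair id (fmu μ r 0) - pair id ξ| < S.εseq n')

/-- the set B_L of uniform limits of good paths: weakly continuous M_F-valued paths
on [0,L] that are uniform (in the metric d) limits of paths ζ^j ∈ B_L^{r̃_j} along a
subsequence r̃_j → ∞ of R. -/
def Setting.memBL (S : Setting) (L : ℝ) (ζ : ℝ → Measure ℝ) : Prop :=
  (∀ t ∈ Set.Icc (0:ℝ) L, IsFiniteMeasure (ζ t) ∧ ζ t (Set.Iio 0) = 0) ∧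
  (∀ t ∈ Set.Icc (0:ℝ) L, ∀ ε : ℝ, 0 < ε → ∃ δ : ℝ, 0 < δ ∧
    ∀ s ∈ Set.Icc (0:ℝ) L, |s - t| < δ → dmet S.gmet S.hmet (ζ s) (ζ t) < ε) ∧
  ∃ (φ : ℕ → ℕ) (ζs : ℕ → ℝ → Measure ℝ), StrictMono φ ∧
    (∀ j, S.memBLr L (S.R (φ j)) (ζs j)) ∧
    ∀ ε : ℝ, 0 < ε → ∃ J : ℕ, ∀ j, J ≤ j → ∀ t ∈ Set.Icc (0:ℝ) L,
      dmet S.gmet S.hmet (ζs j t) (ζ t) ≤ ε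

end PSQ

namespace PSQ

/-- The function `f` restricted to the positive half-line and extended by zero. -/
noncomputable def cut (f : ℝ → ℝ) (y : ℝ) : ℝ := if 0 < y then f y else 0

lemma integral_dplus_pos (f : ℝ → ℝ) (y : ℝ) : ∫ x, f x ∂(dplus (pos y)) = cut f y := by
  unfold dplus pos cut
  by_cases hy : 0 < y
  · simp [hy, max_eq_left hy.le]
  · simp [hy]

lemma integrable_dplus_pos (f : ℝ → ℝ) (y : ℝ) : Integrable f (dplus (pos y)) := by
  unfold dplus
  split_ifs
  · exact integrable_dirac (by simp)
  · exact integrable_zero_measure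

lemma cut_mono {f g : ℝ → ℝ} (h : ∀ x, 0 < x → f x ≤ g x) (y : ℝ) : cut f y ≤ cut g y := by
  unfold cut
  split_ifs with hy
  · exact h y hy
  · exact le_rfl

lemma cut_cut_sub {D : ℝ} (hD : 0 ≤ D) (f : ℝ → ℝ) (y : ℝ) :
    cut (fun x => cut f (x - D)) y = cut f (y - D) := by
  simp only [cut]
  split_ifs <;> first | rfl | (exfalso; linarith)

/-- A processor-sharing path: the data together with its state descriptor. -/
structure Path where
  U : ℕ → ℝ
  v : ℕ → ℝ
  Z0 : ℕ
  vt : ℕ → ℝ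
  μ : ℝ → Measure ℝ
  S : ℝ → ℝ
  hQ : QueueHyps U v Z0 vt
  hS : StateEqns U v Z0 vt μ S

namespace Path
variable (P : Path)

/-- Pairing of a test function with the (unscaled) state descriptor, in terms of the data. -/
noncomputable def F (f : ℝ → ℝ) (t : ℝ) : ℝ :=
  ∑ j ∈ Finset.range P.Z0, cut f (P.vt (j+1) - P.S t) +
    ∑ i ∈ Finset.Ioc 0 (Ecount P.U t), cut f (P.v i - P.S t + P.S (P.U i))

lemma bddAbove_count (t : ℝ) : BddAbove {i : ℕ | P.U i ≤ t} := by
  obtain ⟨N, hN⟩ := (P.hQ.2.2.2.1.eventually (eventually_gt_atTop t)).exists_forall_of_atTop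
  refine ⟨N, fun i hi => ?_⟩
  by_contra! h
  exact absurd hi (not_le.2 (hN i h.le))

lemma le_count_iff {t : ℝ} (ht : 0 ≤ t) (i : ℕ) : i ≤ Ecount P.U t ↔ P.U i ≤ t := by
  constructor
  · intro h
    have hne : {i : ℕ | P.U i ≤ t}.Nonempty := ⟨0, by simp [P.hQ.1, ht]⟩
    exact (P.hQ.2.1 h).trans (Nat.sSup_mem hne (P.bddAbove_count t))
  · intro h
    exact le_csSup (P.bddAbove_count t) h

lemma count_mono {s t : ℝ} (hs : 0 ≤ s) (hst : s ≤ t) : Ecount P.U s ≤ Ecount P.U t :=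
  (P.le_count_iff (hs.trans hst) _).2 (((P.le_count_iff hs _).1 le_rfl).trans hst)

lemma pair_mu (f : ℝ → ℝ) {t : ℝ} (ht : 0 ≤ t) : pair f (P.μ t) = P.F f t := by
  unfold pair F
  rw [(P.hS t ht).2]
  rw [integral_add_measure, integral_finsetSum_measure, integral_finsetSum_measure]
  · simp only [integral_dplus_pos]
    congr 1
    rw [Finset.range_eq_Ico, Finset.sum_Ico_add' (fun i => cut f (P.v i - P.S t + P.S (P.U i)))]
    rfl
  · intros; exact integrable_dplus_pos _ _
  · intros; exact integrable_dplus_pos _ _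
  · exact integrable_finsetSum_measure.2 (fun i _ => integrable_dplus_pos _ _)
  · exact integrable_finsetSum_measure.2 (fun i _ => integrable_dplus_pos _ _)

lemma isFiniteMeasure_mu {t : ℝ} (ht : 0 ≤ t) : IsFiniteMeasure (P.μ t) := by
  have h : ∀ x, IsFiniteMeasure (dplus x) := by
    intro x; unfold dplus; split_ifs <;> infer_instance
  rw [(P.hS t ht).2]
  infer_instance

lemma integrable_mu (f : ℝ → ℝ) {t : ℝ} (ht : 0 ≤ t) : Integrable f (P.μ t) := by
  rw [(P.hS t ht).2]
  exact (integrable_finsetSum_measure.2 (fun i _ => integrable_dplus_pos _ _)).add_measure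
    (integrable_finsetSum_measure.2 (fun i _ => integrable_dplus_pos _ _))

lemma mass_mu {t : ℝ} (ht : 0 ≤ t) : mass (P.μ t) = P.F (fun _ => 1) t := by
  rw [← P.pair_mu _ ht]
  simp [pair, mass, Measure.real]

lemma pair_fmu (f : ℝ → ℝ) {r t : ℝ} (hr : 0 < r) (ht : 0 ≤ t) :
    pair f (fmu P.μ r t) = P.F f (r * t) / r := by
  rw [← P.pair_mu f (by positivity)]
  unfold pair fmu
  rw [integral_smul_measure, ENNReal.toReal_ofReal (by positivity), smul_eq_mul]
  ring

lemma F_mono {f g : ℝ → ℝ} (h : ∀ x, 0 < x → f x ≤ g x) (t : ℝ) : P.F f t ≤ P.F g t := by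
  unfold F
  gcongr <;> exact cut_mono h _

lemma F_add (f g : ℝ → ℝ) (t : ℝ) : P.F (fun x => f x + g x) t = P.F f t + P.F g t := by
  have h : ∀ y, cut (fun x => f x + g x) y = cut f y + cut g y := by
    intro y; unfold cut; split_ifs <;> simp
  simp only [F, h, Finset.sum_add_distrib]
  ring

lemma F_const_mul (c : ℝ) (f : ℝ → ℝ) (t : ℝ) : P.F (fun x => c * f x) t = c * P.F f t := by
  have h : ∀ y, cut (fun x => c * f x) y = c * cut f y := by
    intro y; unfold cut; split_ifs <;> simp
  simp only [F, h, ← Finset.mul_sum]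
  ring

lemma F_sub (f g : ℝ → ℝ) (t : ℝ) : P.F (fun x => f x - g x) t = P.F f t - P.F g t := by
  have := P.F_add (fun x => f x - g x) g t
  simp only [sub_add_cancel] at this
  linarith

/-- Evolution of the state between two times. -/
lemma F_step (f : ℝ → ℝ) {s t : ℝ} (hs : 0 ≤ s) (hst : s ≤ t) (hD : P.S s ≤ P.S t) :
    P.F f t = P.F (fun x => cut f (x - (P.S t - P.S s))) s +
      ∑ i ∈ Finset.Ioc (Ecount P.U s) (Ecount P.U t), cut f (P.v i - (P.S t - P.S (P.U i))) := by
  unfold F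
  rw [← Finset.sum_Ioc_consecutive _ (Nat.zero_le _) (P.count_mono hs hst), ← add_assoc]
  simp only [cut_cut_sub (sub_nonneg.2 hD)]
  congr 1
  · congr 1 <;> refine Finset.sum_congr rfl fun i _ => ?_ <;> congr 1 <;> ring
  · refine Finset.sum_congr rfl fun i _ => ?_
    congr 1; ring

lemma F_one_eq_zero_or_one_le (t : ℝ) :
    P.F (fun _ => 1) t = 0 ∨ 1 ≤ P.F (fun _ => 1) t := by
  have h : ∀ y, cut (fun _ => 1) y = (((if 0 < y then 1 else 0 : ℕ)) : ℝ) := by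
    intro y; unfold cut; split_ifs <;> simp
  unfold F
  simp only [h]
  rw [← Nat.cast_sum, ← Nat.cast_sum, ← Nat.cast_add]
  norm_cast
  omega

lemma rate_mem_Icc {t : ℝ} (ht : 0 ≤ t) : (mass (P.μ t))⁻¹ ∈ Icc (0:ℝ) 1 := by
  rw [P.mass_mu ht]
  rcases P.F_one_eq_zero_or_one_le t with h | h
  · simp [h]
  · exact ⟨by positivity, inv_le_one_of_one_le₀ h⟩

lemma measurable_count : AEMeasurable (fun t => (Ecount P.U t)) (volume.restrict (Ici (0:ℝ))) :=
  aemeasurable_restrict_of_monotoneOn measurableSet_Ici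
    (fun _ ha _ _ hab => P.count_mono ha hab)

lemma aemeasurable_rate {B : Set ℝ} (hB0 : B ⊆ Ici 0)
    (hSB : AEMeasurable P.S (volume.restrict B)) :
    AEMeasurable (fun t => (mass (P.μ t))⁻¹) (volume.restrict B) := by
  have hcut : Measurable (cut (fun _ => 1)) := by
    unfold cut
    exact Measurable.ite measurableSet_Ioi measurable_const measurable_const
  let G : ℝ × ℕ → ℝ := fun q => ∑ j ∈ Finset.range P.Z0, cut (fun _ => 1) (P.vt (j+1) - q.1) +
    ∑ i ∈ Finset.Ioc 0 q.2, cut (fun _ => 1) (P.v i - q.1 + P.S (P.U i))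
  have hG : Measurable G := by
    refine measurable_from_prod_countable_left fun n => ?_
    simp only [G]
    refine Measurable.add ?_ ?_
    · exact Finset.measurable_fun_sum _ fun i _ => hcut.comp (by fun_prop)
    · exact Finset.measurable_fun_sum _ fun i _ => hcut.comp (by fun_prop)
  have h1 : AEMeasurable (fun t => (G (P.S t, Ecount P.U t))⁻¹) (volume.restrict B) :=
    (hG.comp_aemeasurable (hSB.prodMk
      (P.measurable_count.mono_measure (Measure.restrict_mono hB0 le_rfl)))).inv
  refine h1.congr ?_
  have h0 : ∀ᵐ t ∂(volume.restrict B), t ∈ Ici (0:ℝ) :=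
    ae_mono (Measure.restrict_mono hB0 le_rfl) (ae_restrict_mem measurableSet_Ici)
  filter_upwards [h0] with t ht
  rw [P.mass_mu ht]
  rfl

lemma aemeasurable_rate_Ici :
    AEMeasurable (fun t => (mass (P.μ t))⁻¹) (volume.restrict (Ici (0:ℝ))) := by
  set f : ℝ → ℝ := fun t => (mass (P.μ t))⁻¹ with hf
  let A : Set ℝ := {t | 0 ≤ t ∧ IntervalIntegrable f volume 0 t}
  have hA : OrdConnected A := by
    refine ⟨fun x hx y hy z hz => ⟨hx.1.trans hz.1, hy.2.mono_set ?_⟩⟩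
    rw [uIcc_of_le (hx.1.trans hz.1), uIcc_of_le hy.1]
    exact Icc_subset_Icc_right hz.2
  have hA0 : A ⊆ Ici 0 := fun t ht => ht.1
  have hAm : MeasurableSet A := hA.measurableSet
  have hmono : MonotoneOn P.S A := by
    intro x hx y hy hxy
    rw [(P.hS x hx.1).1, (P.hS y hy.1).1]
    refine intervalIntegral.integral_mono_interval le_rfl hx.1 hxy ?_ hy.2
    filter_upwards [ae_restrict_mem measurableSet_Ioc] with t ht
    exact (P.rate_mem_Icc ht.1.le).1
  have h1 := P.aemeasurable_rate hA0 (aemeasurable_restrict_of_monotoneOn hAm hmono)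
  have h2 : AEMeasurable f (volume.restrict (Ici 0 \ A)) := by
    refine P.aemeasurable_rate sdiff_subset ?_
    refine (aemeasurable_const (b := (0:ℝ))).congr ?_
    filter_upwards [ae_restrict_mem (measurableSet_Ici.diff hAm)] with t ht
    rw [(P.hS t ht.1).1, intervalIntegral.integral_undef]
    exact fun h => ht.2 ⟨ht.1, h⟩
  have h3 := aemeasurable_union_iff.2 ⟨h1, h2⟩
  rwa [union_sdiff_cancel hA0] at h3

lemma intervalIntegrable_rate {s t : ℝ} (hs : 0 ≤ s) (ht : 0 ≤ t) :
    IntervalIntegrable (fun t => (mass (P.μ t))⁻¹) volume s t := by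
  have hsub : uIoc s t ⊆ Ici 0 := fun x hx => ((le_min hs ht).trans hx.1.le)
  refine (intervalIntegrable_const (c := (1:ℝ))).mono_fun ?_ ?_
  · exact (P.aemeasurable_rate_Ici.mono_measure
      (Measure.restrict_mono hsub le_rfl)).aestronglyMeasurable
  · filter_upwards [ae_restrict_mem measurableSet_uIoc] with x hx
    have := P.rate_mem_Icc (hsub hx)
    rw [Real.norm_of_nonneg this.1]
    simpa using this.2

lemma S_sub {s t : ℝ} (hs : 0 ≤ s) (ht : 0 ≤ t) :
    P.S t - P.S s = ∫ x in s..t, (mass (P.μ x))⁻¹ := by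
  rw [(P.hS t ht).1, (P.hS s hs).1]
  exact intervalIntegral.integral_interval_sub_left (P.intervalIntegrable_rate le_rfl ht)
    (P.intervalIntegrable_rate le_rfl hs)

lemma mul_sub_le_S_sub {s t c : ℝ} (hs : 0 ≤ s) (hst : s ≤ t)
    (h : ∀ x ∈ Ioo s t, c ≤ (mass (P.μ x))⁻¹) : c * (t - s) ≤ P.S t - P.S s := by
  rw [P.S_sub hs (hs.trans hst)]
  have := intervalIntegral.integral_mono_on_of_le_Ioo (f := fun _ => c) hst (by simp)
    (P.intervalIntegrable_rate hs (hs.trans hst)) h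
  simp only [intervalIntegral.integral_const, smul_eq_mul] at this
  linarith

lemma S_sub_le_mul {s t c : ℝ} (hs : 0 ≤ s) (hst : s ≤ t)
    (h : ∀ x ∈ Ioo s t, (mass (P.μ x))⁻¹ ≤ c) : P.S t - P.S s ≤ c * (t - s) := by
  rw [P.S_sub hs (hs.trans hst)]
  have := intervalIntegral.integral_mono_on_of_le_Ioo (g := fun _ => c) hst
    (P.intervalIntegrable_rate hs (hs.trans hst)) (by simp) h
  simp only [intervalIntegral.integral_const, smul_eq_mul] at this
  linarith

lemma S_mono {s t : ℝ} (hs : 0 ≤ s) (hst : s ≤ t) : P.S s ≤ P.S t := by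
  have := P.mul_sub_le_S_sub (c := 0) hs hst
    (fun x hx => (P.rate_mem_Icc (hs.trans hx.1.le)).1)
  linarith

lemma S_sub_le {s t : ℝ} (hs : 0 ≤ s) (hst : s ≤ t) : P.S t - P.S s ≤ t - s := by
  have := P.S_sub_le_mul (c := 1) hs hst
    (fun x hx => (P.rate_mem_Icc (hs.trans hx.1.le)).2)
  linarith

lemma continuousOn_S : ContinuousOn P.S (Ici 0) := by
  refine LipschitzOnWith.continuousOn (K := 1) (LipschitzOnWith.of_dist_le_mul ?_)
  intro x hx y hy
  simp only [NNReal.coe_one, one_mul, Real.dist_eq]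
  rcases le_total x y with h | h
  · rw [abs_sub_comm, abs_sub_comm x y, abs_of_nonneg (sub_nonneg.2 (P.S_mono hx h)),
      abs_of_nonneg (sub_nonneg.2 h)]
    exact P.S_sub_le hx h
  · rw [abs_of_nonneg (sub_nonneg.2 (P.S_mono hy h)), abs_of_nonneg (sub_nonneg.2 h)]
    exact P.S_sub_le hy h

end Path

/-- The bins widened by half their length on both sides. -/
noncomputable def wideBin (ν : Measure ℝ) (κ : ℝ) (k : ℕ) : ℝ :=
  ν.real (Ico (((k:ℝ) - 1/2) * κ) (((k:ℝ) + 3/2) * κ))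

lemma sum_measureReal_Ico_le_one (ν : Measure ℝ) [IsProbabilityMeasure ν] {κ : ℝ} (hκ : 0 < κ)
    (c : ℝ) (s : Finset ℕ) :
    ∑ k ∈ s, ν.real (Ico (((k:ℝ) + c) * κ) (((k:ℝ) + c + 1) * κ)) ≤ 1 := by
  rw [← measureReal_biUnion_finset]
  · exact measureReal_le_one
  · intro i _ j _ hij
    refine Set.disjoint_left.2 fun x hx hx' => hij ?_
    have h1 : ((i:ℝ) + c) < (j:ℝ) + c + 1 := lt_of_mul_lt_mul_right (hx.1.trans_lt hx'.2) hκ.le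
    have h2 : ((j:ℝ) + c) < (i:ℝ) + c + 1 := lt_of_mul_lt_mul_right (hx'.1.trans_lt hx.2) hκ.le
    have h3 : (i:ℝ) < (j:ℝ) + 1 := by linarith
    have h4 : (j:ℝ) < (i:ℝ) + 1 := by linarith
    norm_cast at h3 h4
    omega
  · intros; exact measurableSet_Ico

lemma wideBin_nonneg (ν : Measure ℝ) (κ : ℝ) (k : ℕ) : 0 ≤ wideBin ν κ k := measureReal_nonneg

lemma sum_wideBin_le (ν : Measure ℝ) [IsProbabilityMeasure ν] {κ : ℝ} (hκ : 0 < κ)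
    (s : Finset ℕ) : ∑ k ∈ s, wideBin ν κ k ≤ 2 := by
  have h : ∀ k ∈ s, wideBin ν κ k ≤ ν.real (Ico (((k:ℝ) + (-1/2)) * κ) (((k:ℝ) + (-1/2) + 1) * κ))
      + ν.real (Ico (((k:ℝ) + 1/2) * κ) (((k:ℝ) + 1/2 + 1) * κ)) := by
    intro k _
    refine (measureReal_mono ?_).trans (measureReal_union_le _ _)
    intro x hx
    by_cases h : x < ((k:ℝ) + 1/2) * κ
    · left; constructor
      · have := hx.1; linarith
      · linarith
    · right; constructor
      · linarith
      · have := hx.2; linarith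
  refine (Finset.sum_le_sum h).trans ?_
  rw [Finset.sum_add_distrib]
  have h1 := sum_measureReal_Ico_le_one ν hκ (-1/2) s
  have h2 := sum_measureReal_Ico_le_one ν hκ (1/2) s
  linarith

/-- The good-path bounds at one level, in unscaled time on `[0, H]`. -/
structure Path.Level (P : Path) (ν : Measure ℝ) (r H ε l κ M p : ℝ) : Prop where
  hr : 0 < r
  hε : 0 < ε
  hε1 : ε < 1
  hl : 0 < l
  hκ : 0 < κ
  hM : 1 < M
  hκl : κ < l / (2 * M)
  arr : ∀ u ∈ Icc 0 H, (Ecount P.U (u + r * l) : ℝ) - Ecount P.U u ≤ r * (ε / 16)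
  mass_le : ∀ u ∈ Icc 0 H, P.F (fun _ => 1) u ≤ r * M
  first_le : ∀ u ∈ Icc 0 H, P.F id u ≤ r * M
  moment_le : ∀ u ∈ Icc 0 H, P.F (fun x => x ^ (1 + p)) u ≤ r * M
  init : ∀ x, 0 ≤ x → P.F ((Icc x (x + κ)).indicator 1) 0 ≤ r * (ε / 4)
  bin : ∀ u ∈ Icc 0 H, ∀ k : ℕ, k ≤ ⌈64*M^2/(κ*ε^2)⌉₊ + 1 →
    (∑ i ∈ Finset.Ioc (Ecount P.U u) (Ecount P.U (u + r * l)),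
      if (k:ℝ)*κ ≤ P.v i ∧ P.v i < ((k:ℝ)+1)*κ then (1:ℝ) else 0) ≤ r * (ε/8) * wideBin ν κ k

namespace Path
variable {P : Path} {ν : Measure ℝ} {r H ε l κ M p : ℝ}

lemma sum_arrivals_le {f : ℝ → ℝ} (hf : ∀ x, 0 < x → f x ≤ 1) (y : ℕ → ℝ) {s t : ℝ} (hs : 0 ≤ s)
    (hst : s ≤ t) : ∑ i ∈ Finset.Ioc (Ecount P.U s) (Ecount P.U t), cut f (y i) ≤
      (Ecount P.U t : ℝ) - Ecount P.U s := by
  refine (Finset.sum_le_card_nsmul _ _ 1 fun i _ => ?_).trans ?_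
  · unfold cut
    split_ifs with h
    · exact hf _ h
    · exact zero_le_one
  · simp [Nat.cast_sub (P.count_mono hs hst)]

lemma Level.arrivals_le (h : P.Level ν r H ε l κ M p) {f : ℝ → ℝ} (hf : ∀ x, 0 < x → f x ≤ 1)
    (y : ℕ → ℝ) {s t : ℝ} (hs : s ∈ Icc 0 H) (hst : s ≤ t) (ht : t ≤ s + r * l) :
    ∑ i ∈ Finset.Ioc (Ecount P.U s) (Ecount P.U t), cut f (y i) ≤ r * (ε / 16) := by
  refine (P.sum_arrivals_le hf y hs.1 hst).trans ?_
  have h1 := h.arr s hs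
  have h2 : (Ecount P.U t : ℝ) ≤ Ecount P.U (s + r * l) :=
    Nat.cast_le.2 (P.count_mono (hs.1.trans hst) ht)
  linarith

/-- Arrivals during one window which end up close to the origin at time `t`. -/
lemma Level.window_le (h : P.Level ν r H ε l κ M p) {a t : ℝ} (ha : a ∈ Icc 0 H)
    (hat : a + r * l ≤ t) (hK : P.S t - P.S a ≤ 64 * M ^ 2 / ε ^ 2) :
    ∑ i ∈ Finset.Ioc (Ecount P.U a) (Ecount P.U (a + r * l)),
        cut ((Ioc 0 κ).indicator 1) (P.v i - (P.S t - P.S (P.U i))) ≤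
      r * (ε / 8) * ∑ k ∈ Finset.Icc ⌊(P.S t - P.S (a + r * l)) / κ⌋₊
        (⌊(P.S t - P.S a) / κ⌋₊ + 1), wideBin ν κ k := by
  have hκ := h.hκ
  have hrl : 0 < r * l := mul_pos h.hr h.hl
  have hb : 0 ≤ a + r * l := by linarith [ha.1]
  have hDa : 0 ≤ P.S t - P.S a := sub_nonneg.2 (P.S_mono ha.1 (by linarith))
  set q := ⌊(P.S t - P.S a) / κ⌋₊ with hq
  set q' := ⌊(P.S t - P.S (a + r * l)) / κ⌋₊ with hq'
  have key : ∀ i ∈ Finset.Ioc (Ecount P.U a) (Ecount P.U (a + r * l)),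
      cut ((Ioc 0 κ).indicator 1) (P.v i - (P.S t - P.S (P.U i))) ≤
      ∑ k ∈ Finset.Icc q' (q + 1),
        if (k:ℝ)*κ ≤ P.v i ∧ P.v i < ((k:ℝ)+1)*κ then (1:ℝ) else 0 := by
    intro i hi
    rw [Finset.mem_Ioc] at hi
    have hUi : a < P.U i := by
      rw [← not_le, P.le_count_iff ha.1 i |>.symm]; omega
    have hUi' : P.U i ≤ a + r * l := (P.le_count_iff hb i).1 hi.2
    have hS1 := P.S_mono ha.1 hUi.le
    have hS2 := P.S_mono (ha.1.trans hUi.le) hUi'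
    have hS3 := P.S_mono hb hat
    have hnn : ∀ k ∈ Finset.Icc q' (q + 1),
        (0:ℝ) ≤ if (k:ℝ)*κ ≤ P.v i ∧ P.v i < ((k:ℝ)+1)*κ then (1:ℝ) else 0 := by
      intro k _; split_ifs <;> norm_num
    unfold cut
    by_cases hx : P.v i - (P.S t - P.S (P.U i)) ∈ Ioc 0 κ
    · rw [if_pos hx.1, indicator_of_mem hx]
      have hv0 : 0 ≤ P.v i / κ := div_nonneg (by linarith [hx.1]) hκ.le
      refine le_trans (le_of_eq ?_)
        (Finset.single_le_sum hnn (a := ⌊P.v i / κ⌋₊) (Finset.mem_Icc.2 ⟨?_, ?_⟩))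
      · rw [if_pos]
        · rfl
        · exact ⟨(le_div_iff₀ hκ).1 (Nat.floor_le hv0), (div_lt_iff₀ hκ).1 (Nat.lt_floor_add_one _)⟩
      · refine Nat.floor_le_floor (div_le_div_of_nonneg_right ?_ hκ.le)
        linarith [hx.1]
      · rw [hq, ← Nat.floor_add_one (div_nonneg hDa hκ.le)]
        refine Nat.floor_le_floor ?_
        rw [div_add_one hκ.ne']
        refine div_le_div_of_nonneg_right ?_ hκ.le
        linarith [hx.2]
    · rw [indicator_of_notMem hx]
      simp
  refine (Finset.sum_le_sum key).trans ?_
  rw [Finset.sum_comm, Finset.mul_sum]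
  refine Finset.sum_le_sum fun k hk => h.bin a ha k ?_
  refine (Finset.mem_Icc.1 hk).2.trans (Nat.add_le_add_right ?_ 1)
  refine (Nat.floor_le_floor ?_).trans (Nat.floor_le_ceil _)
  rw [mul_comm κ, ← div_div]
  exact div_le_div_of_nonneg_right hK hκ.le

lemma Level.rate_mem (h : P.Level ν r H ε l κ M p) {u : ℝ} (hu : u ∈ Icc 0 H)
    (hm : r * ε ≤ P.F (fun _ => 1) u) :
    (r * M)⁻¹ ≤ (mass (P.μ u))⁻¹ ∧ (mass (P.μ u))⁻¹ ≤ (r * ε)⁻¹ := by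
  have h0 : 0 < r * ε := mul_pos h.hr h.hε
  rw [P.mass_mu hu.1]
  exact ⟨inv_anti₀ (h0.trans_le hm) (h.mass_le u hu), inv_anti₀ h0 hm⟩

/-- Arrivals close to the origin at time `t` that arrived during a busy period. -/
lemma Level.busy_le [IsProbabilityMeasure ν] (h : P.Level ν r H ε l κ M p) {s t : ℝ} (hs : 0 ≤ s)
    (hst : s ≤ t) (ht : t ≤ H) (hbusy : ∀ u ∈ Icc s t, r * ε ≤ P.F (fun _ => 1) u)
    (hK : ∀ u ∈ Icc s t, P.S t - P.S u ≤ 64 * M ^ 2 / ε ^ 2) :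
    ∑ i ∈ Finset.Ioc (Ecount P.U s) (Ecount P.U t),
        cut ((Ioc 0 κ).indicator 1) (P.v i - (P.S t - P.S (P.U i))) ≤
      r * (ε / 16) + r * (ε / 2) := by
  have hκ := h.hκ
  have hrl : 0 < r * l := mul_pos h.hr h.hl
  have hr8 : 0 < r * (ε / 8) := mul_pos h.hr (by linarith [h.hε])
  let a : ℕ → ℝ := fun j => s + j * (r * l)
  let q : ℕ → ℕ := fun j => ⌊(P.S t - P.S (a j)) / κ⌋₊
  have ha0 : ∀ j, s ≤ a j := fun j => by simp only [a]; nlinarith [(Nat.cast_nonneg j : (0:ℝ) ≤ j)]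
  have hasucc : ∀ j, a (j + 1) = a j + r * l := fun j => by simp only [a]; push_cast; ring
  have hqq : ∀ j, a (j + 1) ≤ t → q (j + 1) + 2 ≤ q j := by
    intro j hj
    have h1 : (r * M)⁻¹ * (a (j + 1) - a j) ≤ P.S (a (j+1)) - P.S (a j) := by
      refine P.mul_sub_le_S_sub (hs.trans (ha0 j)) (by rw [hasucc]; linarith) fun x hx => ?_
      have hx' : x ∈ Icc s t := ⟨(ha0 j).trans hx.1.le, hx.2.le.trans hj⟩
      exact (h.rate_mem ⟨hs.trans hx'.1, hx'.2.trans ht⟩ (hbusy x hx')).1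
    have h2 : (r * M)⁻¹ * (a (j + 1) - a j) = l / M := by
      rw [hasucc]
      have := h.hr; have := h.hM
      field_simp
      ring
    have h3 : 2 * κ ≤ l / M := by
      have := h.hκl
      have hM := h.hM
      rw [lt_div_iff₀ (by positivity)] at this
      rw [le_div_iff₀ (by positivity)]
      linarith
    have hD : 0 ≤ (P.S t - P.S (a (j+1))) / κ :=
      div_nonneg (sub_nonneg.2 (P.S_mono (hs.trans (ha0 _)) hj)) hκ.le
    have h4 : q (j + 1) + 2 = ⌊(P.S t - P.S (a (j+1))) / κ + (2:ℕ)⌋₊ :=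
      (Nat.floor_add_natCast hD 2).symm
    rw [h4]
    refine Nat.floor_le_floor ?_
    rw [div_add' _ _ _ hκ.ne']
    refine div_le_div_of_nonneg_right ?_ hκ.le
    push_cast
    linarith
  have ind : ∀ j, a j ≤ t →
      ∑ i ∈ Finset.Ioc (Ecount P.U s) (Ecount P.U (a j)),
          cut ((Ioc 0 κ).indicator 1) (P.v i - (P.S t - P.S (P.U i))) +
        r * (ε / 8) * ∑ k ∈ Finset.Ico (q j) (q j + 2), wideBin ν κ k ≤
      r * (ε / 8) * (2 * ∑ k ∈ Finset.Ico (q j) (q 0 + 2), wideBin ν κ k) ∧ q j ≤ q 0 := by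
    intro j
    induction j with
    | zero =>
      intro _
      have : a 0 = s := by simp [a]
      rw [this]
      refine ⟨?_, le_rfl⟩
      simp only [Finset.Ioc_self, Finset.sum_empty, zero_add]
      refine mul_le_mul_of_nonneg_left ?_ hr8.le
      have : 0 ≤ ∑ k ∈ Finset.Ico (q 0) (q 0 + 2), wideBin ν κ k :=
        Finset.sum_nonneg fun k _ => wideBin_nonneg ν κ k
      linarith
    | succ j ih =>
      intro hj
      have hj' : a j ≤ t := by rw [hasucc] at hj; linarith
      obtain ⟨ih1, ih2⟩ := ih hj'
      have hq2 := hqq j hj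
      refine ⟨?_, by omega⟩
      have hw := h.window_le (a := a j) (t := t) ⟨hs.trans (ha0 j), hj'.trans ht⟩
        (by rw [← hasucc]; exact hj) (hK _ ⟨ha0 j, hj'⟩)
      rw [← hasucc] at hw
      rw [← Finset.sum_Ioc_consecutive _ (P.count_mono hs (ha0 j))
        (P.count_mono (hs.trans (ha0 j)) (by rw [hasucc]; linarith))]
      have e1 : Finset.Icc (q (j+1)) (q j + 1) = Finset.Ico (q (j+1)) (q j + 2) := by
        ext k; simp only [Finset.mem_Icc, Finset.mem_Ico]; omega
      change _ ≤ r * (ε / 8) * ∑ k ∈ Finset.Icc (q (j+1)) (q j + 1), wideBin ν κ k at hw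
      rw [e1] at hw
      have s1 := Finset.sum_Ico_consecutive (wideBin ν κ) (show q (j+1) ≤ q j by omega)
        (show q j ≤ q j + 2 by omega)
      have s2 := Finset.sum_Ico_consecutive (wideBin ν κ) (show q (j+1) ≤ q j by omega)
        (show q j ≤ q 0 + 2 by omega)
      have s3 := Finset.sum_Ico_consecutive (wideBin ν κ) (show q (j+1) ≤ q (j+1) + 2 by omega)
        (show q (j+1) + 2 ≤ q j by omega)
      have s4 : 0 ≤ ∑ k ∈ Finset.Ico (q (j+1) + 2) (q j), wideBin ν κ k :=
        Finset.sum_nonneg fun k _ => wideBin_nonneg ν κ k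
      rw [← s1] at hw
      rw [← s2]
      nlinarith
  obtain ⟨J, hJ1, hJ2⟩ : ∃ J : ℕ, a J ≤ t ∧ t ≤ a J + r * l := by
    have h0 : 0 ≤ (t - s) / (r * l) := div_nonneg (by linarith) hrl.le
    refine ⟨⌊(t - s) / (r * l)⌋₊, ?_, ?_⟩
    · have := (le_div_iff₀ hrl).1 (Nat.floor_le h0)
      simp only [a]; linarith
    · have := (div_lt_iff₀ hrl).1 (Nat.lt_floor_add_one ((t - s) / (r * l)))
      simp only [a]; linarith
  rw [← Finset.sum_Ioc_consecutive _ (P.count_mono hs (ha0 J)) (P.count_mono (hs.trans (ha0 J)) hJ1)]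
  have hlast := h.arrivals_le (f := (Ioc 0 κ).indicator 1)
    (fun x _ => indicator_le_self' (fun _ _ => zero_le_one) x)
    (fun i => P.v i - (P.S t - P.S (P.U i))) ⟨hs.trans (ha0 J), hJ1.trans ht⟩ hJ1 hJ2
  have h1 := (ind J hJ1).1
  have h2 := sum_wideBin_le ν hκ (Finset.Ico (q J) (q 0 + 2))
  have h3 : 0 ≤ r * (ε / 8) * ∑ k ∈ Finset.Ico (q J) (q J + 2), wideBin ν κ k :=
    mul_nonneg hr8.le (Finset.sum_nonneg fun k _ => wideBin_nonneg ν κ k)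
  nlinarith


lemma indicator_one_le_one (s : Set ℝ) (x : ℝ) : s.indicator (1 : ℝ → ℝ) x ≤ 1 :=
  indicator_le_self' (fun _ _ => zero_le_one) x

/-- Little mass is close to the origin. -/
lemma Level.near_zero_le [IsProbabilityMeasure ν] (h : P.Level ν r H ε l κ M p) {t : ℝ}
    (ht : t ∈ Icc 0 H) : P.F ((Ioc 0 κ).indicator 1) t ≤ r * (2 * ε) := by
  have hr := h.hr
  have hε := h.hε
  have hM := h.hM
  have hrl : 0 < r * l := mul_pos h.hr h.hl
  set K : ℝ := 64 * M ^ 2 / ε ^ 2 with hKdef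
  have hKpos : 0 < K := by positivity
  let G : Set ℝ := {u | u ∈ Icc 0 t ∧ (u = 0 ∨ P.F (fun _ => 1) u < r * ε ∨ K ≤ P.S t - P.S u)}
  have hG0 : (0:ℝ) ∈ G := ⟨⟨le_rfl, ht.1⟩, Or.inl rfl⟩
  have hGb : BddAbove G := ⟨t, fun u hu => hu.1.2⟩
  obtain ⟨s, hsG, hs⟩ := exists_lt_of_lt_csSup ⟨0, hG0⟩ (sub_lt_self (sSup G) hrl)
  have hnot : ∀ u, s + r * l ≤ u → u ∉ G := fun u hu huG => by
    have := le_csSup hGb huG; linarith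
  obtain ⟨⟨hs0, hst⟩, hsG⟩ := hsG
  have hS := P.S_mono hs0 hst
  rw [P.F_step _ hs0 hst hS]
  have hsmall : P.F (fun x => cut ((Ioc 0 κ).indicator 1) (x - (P.S t - P.S s))) s ≤ r * ε := by
    rcases hsG with h0 | h0 | h0
    · rw [h0] at hS ⊢
      refine (P.F_mono (fun x _ => ?_) 0).trans ((h.init (P.S t - P.S 0) (by linarith)).trans
        (mul_le_mul_of_nonneg_left (by linarith) hr.le))
      unfold cut
      by_cases hx : x - (P.S t - P.S 0) ∈ Ioc 0 κ
      · rw [if_pos hx.1, indicator_of_mem hx, indicator_of_mem]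
        · exact le_rfl
        · exact ⟨by linarith [hx.1], by linarith [hx.2]⟩
      · rw [indicator_of_notMem hx, ite_self]
        exact indicator_nonneg (fun _ _ => zero_le_one) _
    · refine (P.F_mono (fun x _ => ?_) s).trans h0.le
      unfold cut
      split_ifs
      · exact indicator_one_le_one _ _
      · exact zero_le_one
    · have h1 : P.F (fun x => cut ((Ioc 0 κ).indicator 1) (x - (P.S t - P.S s))) s ≤
          P.F (fun x => K⁻¹ * id x) s := by
        refine P.F_mono (fun x hx => ?_) s
        unfold cut
        split_ifs with h2
        · refine (indicator_one_le_one _ _).trans ?_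
          rw [id, ← div_eq_inv_mul, le_div_iff₀ hKpos]
          linarith
        · exact mul_nonneg (by positivity) hx.le
      rw [P.F_const_mul] at h1
      refine h1.trans ((mul_le_mul_of_nonneg_left (h.first_le s ⟨hs0, hst.trans ht.2⟩)
        (by positivity)).trans ?_)
      have h3 : K⁻¹ * (r * M) = r * ε * (ε / (64 * M)) := by
        rw [hKdef]; field_simp
      rw [h3]
      refine mul_le_of_le_one_right (by positivity) ?_
      rw [div_le_one (by positivity)]
      linarith [h.hε1]
  have hnew : ∑ i ∈ Finset.Ioc (Ecount P.U s) (Ecount P.U t),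
      cut ((Ioc 0 κ).indicator 1) (P.v i - (P.S t - P.S (P.U i))) ≤ r * ε := by
    rcases le_total t (s + r * l) with h1 | h1
    · refine (h.arrivals_le (fun x _ => indicator_one_le_one _ x) _ ⟨hs0, hst.trans ht.2⟩
        hst h1).trans ?_
      nlinarith
    · have hs1 : 0 ≤ s + r * l := by linarith
      have h2 := h.arrivals_le (f := (Ioc 0 κ).indicator 1) (fun x _ => indicator_one_le_one _ x)
        (fun i => P.v i - (P.S t - P.S (P.U i))) ⟨hs0, hst.trans ht.2⟩
        (show s ≤ s + r * l by linarith) le_rfl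
      have h3 := h.busy_le hs1 h1 ht.2
        (fun u hu => by
          by_contra! hc
          exact hnot u hu.1 ⟨⟨hs1.trans hu.1, hu.2⟩, Or.inr (Or.inl hc)⟩)
        (fun u hu => by
          by_contra! hc
          exact hnot u hu.1 ⟨⟨hs1.trans hu.1, hu.2⟩, Or.inr (Or.inr hc.le)⟩)
      rw [← Finset.sum_Ioc_consecutive _ (P.count_mono hs0 (by linarith)) (P.count_mono hs1 h1)]
      nlinarith
  linarith

/-- Mass that is preserved over a period with little service per job. -/
lemma Level.mass_le_add [IsProbabilityMeasure ν] (h : P.Level ν r H ε l κ M p) {s t : ℝ}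
    (hs : s ∈ Icc 0 H) (hst : s ≤ t) (hκ : P.S t - P.S s ≤ κ) :
    P.F (fun _ => 1) s ≤ P.F (fun _ => 1) t + r * (2 * ε) := by
  have hS := P.S_mono hs.1 hst
  have h1 := P.F_step (fun _ => 1) hs.1 hst hS
  have h2 : 0 ≤ ∑ i ∈ Finset.Ioc (Ecount P.U s) (Ecount P.U t),
      cut (fun _ => 1) (P.v i - (P.S t - P.S (P.U i))) := by
    refine Finset.sum_nonneg fun i _ => ?_
    unfold cut; split_ifs <;> norm_num
  have h3 : P.F (fun _ => 1) s ≤ P.F (fun x => cut (fun _ => 1) (x - (P.S t - P.S s)) +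
      (Ioc 0 κ).indicator 1 x) s := by
    refine P.F_mono (fun x hx => ?_) s
    by_cases hxκ : x ≤ κ
    · rw [indicator_of_mem (show x ∈ Ioc 0 κ from ⟨hx, hxκ⟩)]
      unfold cut; split_ifs <;> simp
    · rw [cut, if_pos (by linarith), indicator_of_notMem (fun h => hxκ h.2)]
      simp
  rw [P.F_add] at h3
  linarith [h.near_zero_le hs]

lemma Level.mass_le_arrivals (h : P.Level ν r H ε l κ M p) {s t : ℝ}
    (hs : s ∈ Icc 0 H) (hst : s ≤ t) (ht : t ≤ s + r * l) :
    P.F (fun _ => 1) t ≤ P.F (fun _ => 1) s + r * (ε / 16) := by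
  have hS := P.S_mono hs.1 hst
  rw [P.F_step (fun _ => 1) hs.1 hst hS]
  refine add_le_add (P.F_mono (fun x _ => ?_) s) (h.arrivals_le (fun _ _ => le_rfl) _ hs hst ht)
  unfold cut; split_ifs <;> norm_num

lemma abs_F_le {f : ℝ → ℝ} {B : ℝ} (hf : ∀ x, 0 < x → |f x| ≤ B) (t : ℝ) :
    |P.F f t| ≤ B * P.F (fun _ => 1) t := by
  have h1 := P.F_mono (f := f) (g := fun _ => B * 1) (fun x hx => by
    rw [mul_one]; exact (abs_le.1 (hf x hx)).2) t
  have h2 := P.F_mono (f := fun _ => (-B) * 1) (g := f) (fun x hx => by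
    rw [mul_one]; exact (abs_le.1 (hf x hx)).1) t
  rw [P.F_const_mul B (fun _ => 1)] at h1
  rw [P.F_const_mul (-B) (fun _ => 1)] at h2
  rw [abs_le]
  constructor <;> linarith

lemma Level.osc_le_of_small [IsProbabilityMeasure ν] (h : P.Level ν r H ε l κ M p) {s t : ℝ}
    (hs : s ∈ Icc 0 H) (hst : s ≤ t) (hκ : P.S t - P.S s ≤ κ) (ht : t ≤ s + r * l)
    {f : ℝ → ℝ} {B C : ℝ} (hB : ∀ x, 0 < x → |f x| ≤ B) (hB0 : 0 ≤ B) (hC0 : 0 ≤ C)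
    (hC : ∀ x y, 0 < x → x ≤ y → |f x - f y| ≤ C * (y - x)) :
    |P.F f t - P.F f s| ≤ r * (C * κ * M + 3 * B * ε) := by
  have hr := h.hr
  have hε := h.hε
  have hS := P.S_mono hs.1 hst
  set D := P.S t - P.S s with hD
  have hD0 : 0 ≤ D := sub_nonneg.2 hS
  have h1 : |P.F (fun x => cut f (x - D)) s - P.F f s| ≤
      C * κ * (r * M) + B * (r * (2 * ε)) := by
    rw [← P.F_sub]
    have hpt : ∀ x, 0 < x → |cut f (x - D) - f x| ≤
        C * κ * 1 + B * (Ioc 0 κ).indicator 1 x := by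
      intro x hx
      have hi : 0 ≤ B * (Ioc 0 κ).indicator (1 : ℝ → ℝ) x :=
        mul_nonneg hB0 (indicator_nonneg (fun _ _ => zero_le_one) _)
      have hCκ : 0 ≤ C * κ := mul_nonneg hC0 h.hκ.le
      unfold cut
      split_ifs with hxD
      · have := hC (x - D) x hxD (by linarith)
        have h3 : C * (x - (x - D)) ≤ C * κ := mul_le_mul_of_nonneg_left (by linarith) hC0
        linarith
      · rw [indicator_of_mem (show x ∈ Ioc 0 κ from ⟨hx, by linarith⟩), zero_sub, abs_neg]
        have := hB x hx
        simp only [Pi.one_apply]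
        linarith
    have hub := P.F_mono (f := fun x => cut f (x - D) - f x) (fun x hx => (abs_le.1 (hpt x hx)).2) s
    have hlb := P.F_mono (f := fun x => (-1) * (C * κ * 1 + B * (Ioc 0 κ).indicator 1 x))
      (g := fun x => cut f (x - D) - f x) (fun x hx => by
        have := (abs_le.1 (hpt x hx)).1; linarith) s
    rw [P.F_const_mul (-1) (fun x => C * κ * 1 + B * (Ioc 0 κ).indicator 1 x)] at hlb
    rw [P.F_add (fun _ => C * κ * 1) (fun x => B * (Ioc 0 κ).indicator 1 x),
      P.F_const_mul (C * κ) (fun _ => 1), P.F_const_mul B] at hub hlb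
    have hm := mul_le_mul_of_nonneg_left (h.mass_le s hs) (mul_nonneg hC0 h.hκ.le)
    have hn := mul_le_mul_of_nonneg_left (h.near_zero_le hs) hB0
    rw [abs_le]
    constructor <;> linarith
  have h2 : |∑ i ∈ Finset.Ioc (Ecount P.U s) (Ecount P.U t),
      cut f (P.v i - (P.S t - P.S (P.U i)))| ≤ B * (r * (ε / 16)) := by
    refine (Finset.abs_sum_le_sum_abs _ _).trans ?_
    have h3 := mul_le_mul_of_nonneg_left (h.arrivals_le (f := fun _ => 1) (fun _ _ => le_rfl)
      (fun i => P.v i - (P.S t - P.S (P.U i))) hs hst ht) hB0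
    refine le_trans ?_ h3
    rw [Finset.mul_sum]
    refine Finset.sum_le_sum fun i _ => ?_
    unfold cut
    split_ifs with hx
    · rw [mul_one]; exact hB _ hx
    · simp
  rw [P.F_step f hs.1 hst hS]
  have h4 : B * (r * (ε / 16)) ≤ B * (r * ε) := by gcongr; linarith
  calc _ = |(P.F (fun x => cut f (x - D)) s - P.F f s) + ∑ i ∈ Finset.Ioc (Ecount P.U s)
        (Ecount P.U t), cut f (P.v i - (P.S t - P.S (P.U i)))| := by congr 1; ring
    _ ≤ _ := (abs_add_le _ _).trans (add_le_add h1 h2)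
    _ ≤ _ := by linarith

/-- Oscillation of the pairing with a bounded Lipschitz function over short periods. -/
lemma Level.osc_le [IsProbabilityMeasure ν] (h : P.Level ν r H ε l κ M p) {s t : ℝ}
    (hs : s ∈ Icc 0 H) (hst : s ≤ t) (htH : t ≤ H) (ht : t ≤ s + r * l)
    (ht' : t < s + r * (κ * ε))
    {f : ℝ → ℝ} {B C : ℝ} (hB : ∀ x, 0 < x → |f x| ≤ B) (hB0 : 0 ≤ B) (hC0 : 0 ≤ C)
    (hC : ∀ x y, 0 < x → x ≤ y → |f x - f y| ≤ C * (y - x)) :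
    |P.F f t - P.F f s| ≤ r * (C * κ * M + 6 * B * ε) := by
  have hr := h.hr
  have hε := h.hε
  have hCκ : 0 ≤ C * κ * M := mul_nonneg (mul_nonneg hC0 h.hκ.le) (by linarith [h.hM])
  have hBε : 0 ≤ B * ε := mul_nonneg hB0 hε.le
  rcases le_or_gt (P.S t - P.S s) κ with hκ | hκ
  · refine (h.osc_le_of_small hs hst hκ ht hB hB0 hC0 hC).trans ?_
    refine mul_le_mul_of_nonneg_left ?_ hr.le
    linarith
  · obtain ⟨w, hw, hwS⟩ : P.S s + κ ∈ P.S '' Icc s t :=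
      intermediate_value_Icc hst (P.continuousOn_S.mono fun x hx => hs.1.trans hx.1)
        ⟨by linarith [h.hκ], by linarith⟩
    obtain ⟨u, hu, hum⟩ : ∃ u ∈ Icc s w, P.F (fun _ => 1) u < r * ε := by
      by_contra! hc
      have h1 := P.S_sub_le_mul (c := (r * ε)⁻¹) hs.1 hw.1 fun x hx =>
        (h.rate_mem ⟨hs.1.trans hx.1.le, hx.2.le.trans (hw.2.trans htH)⟩
          (hc x ⟨hx.1.le, hx.2.le⟩)).2
      have h2 : (r * ε)⁻¹ * (w - s) < κ := by
        rw [← div_eq_inv_mul, div_lt_iff₀ (by positivity)]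
        linarith [hw.2]
      linarith
    have huH : u ∈ Icc 0 H := ⟨hs.1.trans hu.1, hu.2.trans (hw.2.trans htH)⟩
    have hsu := P.S_mono huH.1 hu.2
    have h1 := h.mass_le_add hs hu.1 (by linarith)
    have h2 := h.mass_le_arrivals huH (hu.2.trans hw.2) (by linarith [hu.1])
    have h3 := P.abs_F_le hB s
    have h4 := P.abs_F_le hB t
    have h5 : B * P.F (fun _ => 1) s ≤ B * (r * (3 * ε)) :=
      mul_le_mul_of_nonneg_left (by linarith) hB0
    have h6 : B * P.F (fun _ => 1) t ≤ B * (r * (2 * ε)) :=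
      mul_le_mul_of_nonneg_left (by nlinarith) hB0
    have h7 : |P.F f t - P.F f s| ≤ |P.F f t| + |P.F f s| := abs_sub _ _
    have h8 : 0 ≤ r * (C * κ * M) := mul_nonneg hr.le hCκ
    have h9 : 0 ≤ r * (B * ε) := mul_nonneg hr.le hBε
    linarith

end Path

lemma Path.fmu_Iio (P : Path) {r t : ℝ} (hr : 0 < r) (ht : 0 ≤ t) : fmu P.μ r t (Iio 0) = 0 := by
  have h : ∀ x, dplus (pos x) (Iio 0) = 0 := by
    intro x
    unfold dplus
    split_ifs with hx
    · simp [hx.le]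
    · simp
  have h2 := (P.hS (r * t) (by positivity)).2
  unfold fmu
  rw [h2]
  simp [h]

lemma Path.isFiniteMeasure_fmu (P : Path) {r t : ℝ} (hr : 0 < r) (ht : 0 ≤ t) :
    IsFiniteMeasure (fmu P.μ r t) := by
  have := P.isFiniteMeasure_mu (t := r * t) (by positivity)
  unfold fmu
  exact Measure.smul_finite _ ENNReal.ofReal_ne_top

lemma Path.integrable_fmu (P : Path) (f : ℝ → ℝ) {r t : ℝ} (hr : 0 < r) (ht : 0 ≤ t) :
    Integrable f (fmu P.μ r t) :=
  (P.integrable_mu f (by positivity)).smul_measure ENNReal.ofReal_ne_top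

lemma mass_eq_pair (ζ : Measure ℝ) : mass ζ = pair (fun _ => 1) ζ := by
  simp [pair, mass, Measure.real]

lemma exists_shift {r N L u : ℝ} {K : ℕ} (hr : 0 < r) (hL : 1 < L) (hN : N = K)
    (hu : u ∈ Icc 0 (r * (N + L))) :
    ∃ m : ℕ, m ≤ K ∧ ∃ t ∈ Icc 0 L, u = r * (m + t) := by
  have h0 : 0 ≤ u / r := div_nonneg hu.1 hr.le
  have hur : u / r ≤ K + L := by rw [div_le_iff₀ hr, ← hN]; linarith [hu.2]
  have heq : ∀ m : ℕ, u = r * (m + (u / r - m)) := fun m => by field_simp; ring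
  rcases le_total ⌊u / r⌋₊ K with h | h
  · refine ⟨⌊u / r⌋₊, h, u / r - ⌊u / r⌋₊, ⟨?_, ?_⟩, heq _⟩
    · linarith [Nat.floor_le h0]
    · linarith [Nat.lt_floor_add_one (u / r)]
  · refine ⟨K, le_rfl, u / r - K, ⟨?_, ?_⟩, heq _⟩
    · have : (K : ℝ) ≤ ⌊u / r⌋₊ := Nat.cast_le.2 h
      linarith [Nat.floor_le h0]
    · linarith

/-- The good-path properties give the unscaled bounds. -/
lemma Path.level_of_goodPath (P : Path) {ν : Measure ℝ} {T L r ε l p κ γ M : ℝ} (hr : 0 < r)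
    (hL : 1 < L) (hε : ε ∈ Ioo (0:ℝ) 1) (hl : 0 < l) (hκ : 0 < κ) (hM : 1 < M)
    (hκl : κ < l / (2 * M)) (h : GoodPath P.U P.v P.μ ν T L r ε l p κ γ M) :
    P.Level ν r (r * (⌊r * T⌋₊ + L)) ε l κ M p where
  hr := hr
  hε := hε.1
  hε1 := hε.2
  hl := hl
  hκ := hκ
  hM := hM
  hκl := hκl
  arr u hu := by
    obtain ⟨m, hm, t, ht, rfl⟩ := exists_shift hr hL rfl hu
    have := (h m hm).1 t ht
    unfold fE at this
    rw [← sub_div, div_le_iff₀ hr, mul_add r (m + t) l] at this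
    linarith
  mass_le u hu := by
    obtain ⟨m, hm, t, ht, rfl⟩ := exists_shift hr hL rfl hu
    have := (h m hm).2.1 t ht
    have h0 : (0:ℝ) ≤ m + t := add_nonneg m.cast_nonneg ht.1
    have := (max_le_iff.1 (max_le_iff.1 this).1).1
    rw [mass_eq_pair, P.pair_fmu _ hr h0, div_le_iff₀ hr] at this
    linarith
  first_le u hu := by
    obtain ⟨m, hm, t, ht, rfl⟩ := exists_shift hr hL rfl hu
    have := (h m hm).2.1 t ht
    have h0 : (0:ℝ) ≤ m + t := add_nonneg m.cast_nonneg ht.1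
    have := (max_le_iff.1 (max_le_iff.1 this).1).2
    rw [P.pair_fmu _ hr h0, div_le_iff₀ hr] at this
    linarith
  moment_le u hu := by
    obtain ⟨m, hm, t, ht, rfl⟩ := exists_shift hr hL rfl hu
    have := (h m hm).2.1 t ht
    have h0 : (0:ℝ) ≤ m + t := add_nonneg m.cast_nonneg ht.1
    have := (max_le_iff.1 this).2
    rw [P.pair_fmu _ hr h0, div_le_iff₀ hr] at this
    linarith
  init x hx := by
    have := (h 0 (Nat.zero_le _)).2.2.1 x hx
    have e : (fmu P.μ r 0 (Icc x (x + κ))).toReal =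
        pair ((Icc x (x + κ)).indicator 1) (fmu P.μ r 0) := by
      unfold pair
      rw [integral_indicator_one measurableSet_Icc]
      rfl
    rw [e, P.pair_fmu _ hr le_rfl, div_le_iff₀ hr, mul_zero] at this
    linarith
  bin u hu k hk := by
    obtain ⟨m, hm, t, ht, rfl⟩ := exists_shift hr hL rfl hu
    have := (h m hm).2.2.2.2 t ht k hk
    rw [mul_add r (m + t) l, one_div, inv_mul_le_iff₀ hr, ← mul_assoc] at this
    exact this

/-- Uniform bounds for measures on the half-line. -/
structure MomentBound (M p : ℝ) (ζ : Measure ℝ) : Prop where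
  finite : IsFiniteMeasure ζ
  null : ζ (Iio 0) = 0
  integrable : ∀ f : ℝ → ℝ, Integrable f ζ
  mass_le : pair (fun _ => 1) ζ ≤ M
  first_le : pair id ζ ≤ M
  moment_le : pair (fun x => x ^ (1 + p)) ζ ≤ M

variable {S : Setting} {L r : ℝ} {ζ : ℝ → Measure ℝ}

lemma Setting.memBLr.bounds (hr : 0 < r) (hL : 1 < L) (hζ : S.memBLr L r ζ) :
    (∀ t ∈ Icc 0 L, MomentBound S.M S.p (ζ t)) ∧
    ∀ n ≤ S.nIdx r, ∀ (f : ℝ → ℝ) (B C : ℝ), 0 ≤ B → 0 ≤ C → (∀ x, 0 < x → |f x| ≤ B) →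
      (∀ x y, 0 < x → x ≤ y → |f x - f y| ≤ C * (y - x)) → ∀ s ∈ Icc 0 L, ∀ t ∈ Icc 0 L,
      s ≤ t → t ≤ s + S.lseq n → t < s + S.κseq n * S.εseq n →
      |pair f (ζ t) - pair f (ζ s)| ≤ (C / (64 * S.α) + 6 * B) * S.εseq n := by
  obtain ⟨U, v, Z0, vt, μ, Sf, m, hQ, hS, hm, hζ, h⟩ := hζ
  let P : Path := ⟨U, v, Z0, vt, μ, Sf, hQ, hS⟩
  have := S.hν
  have hlev : ∀ n ≤ S.nIdx r, P.Level S.ν r (r * (⌊r * S.T⌋₊ + L)) (S.εseq n) (S.lseq n)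
      (S.κseq n) S.M S.p := fun n hn =>
    P.level_of_goodPath hr hL (S.hε n) (S.hl n) (S.hκ n) S.hM (S.hκl n) (h n hn).1
  have h0 : ∀ t ∈ Icc 0 L, 0 ≤ (m:ℝ) + t := fun t ht => add_nonneg m.cast_nonneg ht.1
  have hmem : ∀ t ∈ Icc 0 L, r * ((m:ℝ) + t) ∈ Icc 0 (r * (⌊r * S.T⌋₊ + L)) := fun t ht =>
    ⟨mul_nonneg hr.le (h0 t ht),
      mul_le_mul_of_nonneg_left (add_le_add (Nat.cast_le.2 hm) ht.2) hr.le⟩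
  have hpair : ∀ f, ∀ t ∈ Icc 0 L, pair f (ζ t) = P.F f (r * (m + t)) / r := fun f t ht => by
    rw [hζ t ht]; exact P.pair_fmu f hr (h0 t ht)
  constructor
  · intro t ht
    have h1 := hlev 0 (Nat.zero_le _)
    refine ⟨?_, ?_, fun f => ?_, ?_, ?_, ?_⟩
    · rw [hζ t ht]; exact P.isFiniteMeasure_fmu hr (h0 t ht)
    · rw [hζ t ht]; exact P.fmu_Iio hr (h0 t ht)
    · rw [hζ t ht]; exact P.integrable_fmu f hr (h0 t ht)
    · rw [hpair _ t ht, div_le_iff₀ hr, mul_comm S.M]; exact h1.mass_le _ (hmem t ht)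
    · rw [hpair _ t ht, div_le_iff₀ hr, mul_comm S.M]; exact h1.first_le _ (hmem t ht)
    · rw [hpair _ t ht, div_le_iff₀ hr, mul_comm S.M]; exact h1.moment_le _ (hmem t ht)
  · intro n hn f B C hB0 hC0 hB hC s hs t ht hst htl htκ
    have h1 := (hlev n hn).osc_le (hmem s hs)
      (mul_le_mul_of_nonneg_left (add_le_add le_rfl hst) hr.le) (hmem t ht).2
      (by rw [← mul_add]; exact mul_le_mul_of_nonneg_left (by linarith) hr.le)
      (by rw [← mul_add]; exact mul_lt_mul_of_pos_left (by linarith) hr) hB hB0 hC0 hC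
    rw [hpair _ t ht, hpair _ s hs, ← sub_div, abs_div, abs_of_pos hr, div_le_iff₀ hr, mul_comm _ r]
    refine h1.trans (mul_le_mul_of_nonneg_left ?_ hr.le)
    have hα := S.hα
    have hM : 0 < S.M := by linarith [S.hM]
    have h2 : S.κseq n * S.M ≤ S.εseq n / (64 * S.α) := by
      have h3 := S.hκl n
      have h4 := S.hlε n
      rw [lt_div_iff₀ (by positivity)] at h3 h4
      rw [le_div_iff₀ (by positivity)]
      nlinarith
    have h5 := mul_le_mul_of_nonneg_left h2 hC0
    have h6 : C / (64 * S.α) * S.εseq n = C * (S.εseq n / (64 * S.α)) := by ring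
    rw [add_mul, h6]
    linarith

lemma Setting.le_nIdx {n : ℕ} (h : S.rseq n < r) : n ≤ S.nIdx r := by
  refine le_csSup ?_ h
  obtain ⟨N, hN⟩ := (S.hrtop.eventually (eventually_ge_atTop r)).exists_forall_of_atTop
  refine ⟨N, fun i hi => ?_⟩
  by_contra! hc
  exact absurd (hN i hc.le) (not_le.2 hi)

/-- Good paths along a sequence of scaling parameters are asymptotically equicontinuous. -/
lemma Setting.equicontinuous (hL : 1 < L) {ρ : ℕ → ℝ} {ζs : ℕ → ℝ → Measure ℝ}
    (hρ : Tendsto ρ atTop atTop) (hρ0 : ∀ i, 0 < ρ i) (hζ : ∀ i, S.memBLr L (ρ i) (ζs i))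
    {f : ℝ → ℝ} {B C : ℝ} (hB : ∀ x, 0 ≤ x → |f x| ≤ B)
    (hC : ∀ x y, 0 ≤ x → x ≤ y → |f x - f y| ≤ C * (y - x)) {η : ℝ} (hη : 0 < η) :
    ∃ δ > 0, ∀ᶠ i in atTop, ∀ s ∈ Icc 0 L, ∀ t ∈ Icc 0 L, |s - t| < δ →
      |pair f (ζs i s) - pair f (ζs i t)| ≤ η := by
  have hB0 : 0 ≤ B := (abs_nonneg _).trans (hB 0 le_rfl)
  have hC0 : 0 ≤ C := by
    have := (abs_nonneg _).trans (hC 0 1 le_rfl zero_le_one); linarith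
  have hlim : Tendsto (fun n => (C / (64 * S.α) + 6 * B) * S.εseq n) atTop (nhds 0) := by
    simpa using S.hεlim.const_mul (C / (64 * S.α) + 6 * B)
  obtain ⟨n, hn⟩ := (hlim.eventually (eventually_le_nhds hη)).exists
  refine ⟨min (S.lseq n) (S.κseq n * S.εseq n),
    lt_min (S.hl n) (mul_pos (S.hκ n) (S.hε n).1), ?_⟩
  filter_upwards [hρ.eventually (eventually_gt_atTop (S.rseq n))] with i hi
  have hosc := ((hζ i).bounds (hρ0 i) hL).2 n (S.le_nIdx hi) f B C hB0 hC0
    (fun x hx => hB x hx.le) (fun x y hx => hC x y hx.le)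
  have main : ∀ s ∈ Icc 0 L, ∀ t ∈ Icc 0 L, s ≤ t →
      |s - t| < min (S.lseq n) (S.κseq n * S.εseq n) →
      |pair f (ζs i t) - pair f (ζs i s)| ≤ η := by
    intro s hs t ht hst hd
    rw [abs_sub_comm, abs_of_nonneg (by linarith), lt_min_iff] at hd
    exact (hosc s hs t ht hst (by linarith) (by linarith)).trans hn
  intro s hs t ht hd
  rcases le_total s t with h | h
  · rw [abs_sub_comm]; exact main s hs t ht h hd
  · rw [abs_sub_comm] at hd; exact main t ht s hs h hd

variable {M p : ℝ}

lemma ae_nonneg_of_null {ζ : Measure ℝ} (h : ζ (Iio 0) = 0) : ∀ᵐ x ∂ζ, 0 ≤ x := by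
  rw [ae_iff]
  simpa [Iio] using h

lemma pair_le_pair {ζ : Measure ℝ} (h : ζ (Iio 0) = 0) {f g : ℝ → ℝ} (hf : Integrable f ζ)
    (hg : Integrable g ζ) (hfg : ∀ x, 0 ≤ x → f x ≤ g x) : pair f ζ ≤ pair g ζ := by
  refine integral_mono_ae hf hg ?_
  filter_upwards [ae_nonneg_of_null h] with x hx using hfg x hx

lemma MomentBound.measureReal_compl_Icc_le {ζ : Measure ℝ} (h : MomentBound M p ζ) {c : ℝ}
    (hc : 0 < c) : ζ.real (Icc (-c) c)ᶜ ≤ M / c := by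
  have h1 : ζ.real (Icc (-c) c)ᶜ = pair ((Icc (-c) c)ᶜ.indicator 1) ζ :=
    (integral_indicator_one measurableSet_Icc.compl).symm
  have h2 : pair (fun x => c⁻¹ * id x) ζ = c⁻¹ * pair id ζ := integral_const_mul _ _
  rw [h1, div_eq_inv_mul]
  refine le_trans ?_ (mul_le_mul_of_nonneg_left h.first_le (inv_nonneg.2 hc.le))
  rw [← h2]
  refine pair_le_pair h.null (h.integrable _) (h.integrable _) fun x hx => ?_
  by_cases hxc : x ∈ (Icc (-c) c)ᶜ
  · rw [indicator_of_mem hxc, id, ← div_eq_inv_mul, Pi.one_apply, le_div_iff₀ hc, one_mul]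
    by_contra! hlt
    exact hxc ⟨by linarith, hlt.le⟩
  · rw [indicator_of_notMem hxc]
    exact mul_nonneg (inv_nonneg.2 hc.le) hx

/-- Measures with uniform moment bounds have weak limits along ultrafilters. -/
lemma exists_limit_of_momentBound (𝒰 : Ultrafilter ℕ) (hM : 0 ≤ M) {ζs : ℕ → Measure ℝ}
    (h : ∀ i, MomentBound M p (ζs i)) :
    ∃ ζ : Measure ℝ, IsFiniteMeasure ζ ∧ ∀ f : ℝ → ℝ, Continuous f → (∃ C, ∀ x, |f x| ≤ C) →
      Tendsto (fun i => pair f (ζs i)) 𝒰 (nhds (pair f ζ)) := by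
  let m : ℕ → FiniteMeasure ℝ := fun i => ⟨ζs i, (h i).finite⟩
  let u : ℕ → NNReal := fun n => M.toNNReal / ((n:NNReal) + 1)
  have hu : Tendsto u atTop (nhds 0) := by
    rw [← NNReal.tendsto_coe]
    simp only [u, NNReal.coe_div, NNReal.coe_add, NNReal.coe_natCast, NNReal.coe_one,
      NNReal.coe_zero]
    exact tendsto_const_nhds.div_atTop (tendsto_atTop_add_const_right _ _ tendsto_natCast_atTop_atTop)
  have hcomp := isCompact_setOfPred_finiteMeasure_mass_le_compl_isCompact_le (E := ℝ) (u := u)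
    (K := fun n : ℕ => Icc (-((n:ℝ) + 1)) ((n:ℝ) + 1)) M.toNNReal hu (fun n => isCompact_Icc)
    (Or.inl inferInstance)
  have hmem : ∀ i, m i ∈ {μ : FiniteMeasure ℝ | μ.mass ≤ M.toNNReal ∧
      ∀ n : ℕ, μ (Icc (-((n:ℝ) + 1)) ((n:ℝ) + 1))ᶜ ≤ u n} := by
    intro i
    constructor
    · rw [← NNReal.coe_le_coe, Real.coe_toNNReal _ hM]
      have := (h i).mass_le
      rw [← mass_eq_pair] at this
      exact this
    · intro n
      rw [← NNReal.coe_le_coe]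
      have := (h i).measureReal_compl_Icc_le (c := (n:ℝ) + 1) (by positivity)
      simp only [u, NNReal.coe_div, Real.coe_toNNReal _ hM, NNReal.coe_add, NNReal.coe_natCast,
        NNReal.coe_one]
      exact this
  obtain ⟨ζ, -, hζ⟩ := hcomp.ultrafilter_le_nhds (𝒰.map m)
    (le_principal_iff.2 (mem_map.2 (univ_mem' hmem)))
  refine ⟨ζ, inferInstance, fun f hf hC => ?_⟩
  obtain ⟨C, hC⟩ := hC
  have hζ' : Tendsto m (𝒰 : Filter ℕ) (nhds ζ) := hζ
  exact FiniteMeasure.tendsto_iff_forall_integral_tendsto.1 hζ'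
    (BoundedContinuousFunction.ofNormedAddCommGroup f hf C hC)

section Limit
variable {𝒰 : Ultrafilter ℕ} {ζs : ℕ → Measure ℝ} {ζ : Measure ℝ}

lemma limit_null [IsFiniteMeasure ζ] (h : ∀ i, ζs i (Iio 0) = 0)
    (hlim : ∀ f : ℝ → ℝ, Continuous f → (∃ C, ∀ x, |f x| ≤ C) →
      Tendsto (fun i => pair f (ζs i)) 𝒰 (nhds (pair f ζ))) : ζ (Iio 0) = 0 := by
  let f : ℝ → ℝ := fun x => max 0 (min 1 (-x))
  have hf : Continuous f := by fun_prop
  have hf0 : ∀ x, 0 ≤ f x := fun x => le_max_left _ _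
  have hf1 : ∀ x, f x ≤ 1 := fun x => max_le zero_le_one (min_le_left _ _)
  have hb : ∀ x, |f x| ≤ 1 := fun x => by rw [abs_of_nonneg (hf0 x)]; exact hf1 x
  have h0 : ∀ i, pair f (ζs i) = 0 := fun i => by
    refine integral_eq_zero_of_ae ?_
    filter_upwards [ae_nonneg_of_null (h i)] with x hx
    exact max_eq_left ((min_le_right _ _).trans (by linarith))
  have h1 := hlim f hf ⟨1, hb⟩
  simp only [h0] at h1
  have h2 : pair f ζ = 0 := tendsto_nhds_unique h1 tendsto_const_nhds
  have hfint : Integrable f ζ := Integrable.of_bound hf.aestronglyMeasurable 1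
    (Eventually.of_forall hb)
  have h3 := (integral_eq_zero_iff_of_nonneg hf0 hfint).1 h2
  have h4 : ∀ᵐ x ∂ζ, ¬ x < 0 := by
    filter_upwards [h3] with x hx hlt
    have : 0 < f x := lt_max_of_lt_right (lt_min one_pos (by linarith))
    exact absurd hx this.ne'
  rw [ae_iff] at h4
  simpa [Iio] using h4

/-- Bounds on integrals of nonnegative functions pass to weak limits. -/
lemma limit_integrable_le [IsFiniteMeasure ζ] (h : ∀ i, MomentBound M p (ζs i))
    (hlim : ∀ f : ℝ → ℝ, Continuous f → (∃ C, ∀ x, |f x| ≤ C) →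
      Tendsto (fun i => pair f (ζs i)) 𝒰 (nhds (pair f ζ)))
    {f : ℝ → ℝ} (hf : Continuous f) (hf0 : ∀ x, 0 ≤ x → 0 ≤ f x) {c : ℝ}
    (hc : ∀ i, pair f (ζs i) ≤ c) : Integrable f ζ ∧ pair f ζ ≤ c := by
  have hnull := limit_null (fun i => (h i).null) hlim
  have hfae : ∀ᵐ x ∂ζ, 0 ≤ f x := by
    filter_upwards [ae_nonneg_of_null hnull] with x hx using hf0 x hx
  have hc0 : 0 ≤ c := by
    refine le_trans ?_ (hc 0)
    refine integral_nonneg_of_ae ?_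
    filter_upwards [ae_nonneg_of_null (h 0).null] with x hx using hf0 x hx
  let g : ℕ → ℝ → ℝ := fun n x => min (max (f x) 0) n
  have hg : ∀ n, Continuous (g n) := fun n => by fun_prop
  have hg0 : ∀ n x, 0 ≤ g n x := fun n x => le_min (le_max_right _ _) n.cast_nonneg
  have hgb : ∀ n x, |g n x| ≤ n := fun n x => by
    rw [abs_of_nonneg (hg0 n x)]; exact min_le_right _ _
  have hgint : ∀ n, Integrable (g n) ζ := fun n =>
    Integrable.of_bound (hg n).aestronglyMeasurable n (Eventually.of_forall (hgb n))
  have hgc : ∀ n, pair (g n) ζ ≤ c := fun n => by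
    refine le_of_tendsto' (hlim (g n) (hg n) ⟨n, hgb n⟩) fun i => ?_
    refine (pair_le_pair (h i).null ((h i).integrable _) ((h i).integrable _) fun x hx => ?_).trans
      (hc i)
    exact (min_le_left _ _).trans (max_le le_rfl (hf0 x hx))
  have hle : ∫⁻ x, ENNReal.ofReal (f x) ∂ζ ≤ ENNReal.ofReal c := by
    refine le_of_tendsto' (lintegral_tendsto_of_tendsto_of_monotone
      (f := fun n x => ENNReal.ofReal (g n x)) (fun n => (hg n).measurable.ennreal_ofReal.aemeasurable)
      ?_ ?_) fun n => ?_
    · refine Eventually.of_forall fun x i j hij => ENNReal.ofReal_le_ofReal ?_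
      exact min_le_min_left _ (Nat.cast_le.2 hij)
    · filter_upwards [hfae] with x hx
      refine (ENNReal.continuous_ofReal.tendsto _).comp (tendsto_const_nhds.congr' ?_)
      filter_upwards [eventually_ge_atTop ⌈f x⌉₊] with n hn
      simp only [g]
      rw [max_eq_left hx, min_eq_left (Nat.ceil_le.1 hn)]
    · rw [← ofReal_integral_eq_lintegral_ofReal (hgint n) (Eventually.of_forall (hg0 n))]
      exact ENNReal.ofReal_le_ofReal (hgc n)
  have hfint : Integrable f ζ := by
    refine ⟨hf.aestronglyMeasurable, ?_⟩
    rw [hasFiniteIntegral_iff_ofReal hfae]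
    exact hle.trans_lt ENNReal.ofReal_lt_top
  refine ⟨hfint, ?_⟩
  rw [← ofReal_integral_eq_lintegral_ofReal hfint hfae] at hle
  exact (ENNReal.ofReal_le_ofReal_iff hc0).1 hle

end Limit

/-- The metric is controlled by finitely many test functions, given a first moment bound. -/
lemma exists_dmet_le {g h : ℕ → ℝ → ℝ} (hgh : MetricFamilies g h) (M : ℝ) {η : ℝ}
    (hη : 0 < η) : ∃ K : ℕ, ∃ η' > 0, ∀ ζ₁ ζ₂ : Measure ℝ, IsFiniteMeasure ζ₁ → IsFiniteMeasure ζ₂ →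
      ζ₁ (Iio 0) = 0 → ζ₂ (Iio 0) = 0 → Integrable id ζ₁ → Integrable id ζ₂ →
      pair id ζ₁ ≤ M → pair id ζ₂ ≤ M →
      (∀ k < K, |pair (g k) ζ₁ - pair (g k) ζ₂| ≤ η' ∧ |pair (h k) ζ₁ - pair (h k) ζ₂| ≤ η') →
      dmet g h ζ₁ ζ₂ ≤ η := by
  obtain ⟨K₁, hK₁⟩ := exists_pow_lt_of_lt_one (show 0 < η / 4 by linarith)
    (show (2:ℝ)⁻¹ < 1 by norm_num)
  obtain ⟨K₂, hK₂⟩ := exists_nat_gt (4 * |M| / η)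
  refine ⟨max K₁ (K₂ + 1), η / 4, by linarith, fun ζ₁ ζ₂ _ _ hn₁ hn₂ hi₁ hi₂ hM₁ hM₂ hk => ?_⟩
  set K := max K₁ (K₂ + 1) with hK
  have hKp : (2:ℝ)⁻¹ ^ K ≤ η / 4 :=
    (pow_le_pow_of_le_one (by norm_num) (by norm_num) (le_max_left _ _)).trans hK₁.le
  have tail : ∀ ζ : Measure ℝ, IsFiniteMeasure ζ → ζ (Iio 0) = 0 → Integrable id ζ →
      pair id ζ ≤ M → ∀ k, K ≤ k → pair (h k) ζ ∈ Icc 0 (η / 4) := by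
    intro ζ _ hn hi hM k hk
    have hk' : K₂ + 1 ≤ k := (le_max_right _ _).trans hk
    have hkK : (K₂:ℝ) + 1 ≤ k := by exact_mod_cast hk'
    have hkpos : (0:ℝ) < k := by linarith [(Nat.cast_nonneg K₂ : (0:ℝ) ≤ K₂)]
    obtain ⟨hb, hd, h0, -, -⟩ := hgh.2.1 k
    refine ⟨integral_nonneg fun x => (hb x).1, ?_⟩
    have hfint : Integrable (h k) ζ := Integrable.of_bound hd.continuous.aestronglyMeasurable 1
      (Eventually.of_forall fun x => by
        rw [Real.norm_eq_abs, abs_of_nonneg (hb x).1]; exact (hb x).2)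
    have h1 : pair (h k) ζ ≤ pair (fun x => (k:ℝ)⁻¹ * id x) ζ := by
      refine pair_le_pair hn hfint (hi.const_mul _) fun x hx => ?_
      rcases le_total x k with hxk | hxk
      · rw [h0 x ⟨hx, hxk⟩]; exact mul_nonneg (by positivity) hx
      · refine (hb x).2.trans ?_
        rw [id, ← div_eq_inv_mul, le_div_iff₀ hkpos, one_mul]; exact hxk
    have h2 : pair (fun x => (k:ℝ)⁻¹ * id x) ζ = (k:ℝ)⁻¹ * pair id ζ := integral_const_mul _ _
    rw [h2, ← div_eq_inv_mul] at h1
    refine h1.trans ?_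
    rw [div_le_iff₀ hkpos]
    have h3 : 4 * |M| < η * k := by
      have := (div_lt_iff₀ hη).1 hK₂
      nlinarith
    linarith [le_abs_self M]
  unfold dmet
  have hsup : ⨆ k : ℕ, |pair (h k) ζ₁ - pair (h k) ζ₂| ≤ η / 4 := by
    refine ciSup_le fun k => ?_
    rcases lt_or_ge k K with hkK | hkK
    · exact (hk k hkK).2
    · have t1 := tail ζ₁ inferInstance hn₁ hi₁ hM₁ k hkK
      have t2 := tail ζ₂ inferInstance hn₂ hi₂ hM₂ k hkK
      rw [abs_le]; constructor <;> linarith [t1.1, t1.2, t2.1, t2.2]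
  set a : ℕ → ℝ := fun k => (2:ℝ)⁻¹^(k+1) * min |pair (g k) ζ₁ - pair (g k) ζ₂| 1 with ha
  have hgeo : HasSum (fun k : ℕ => (2:ℝ)⁻¹ ^ (k + 1)) 1 := by
    have := (hasSum_geometric_of_lt_one (r := (2:ℝ)⁻¹) (by norm_num) (by norm_num)).mul_right (2:ℝ)⁻¹
    norm_num at this
    simpa [pow_succ] using this
  have ha0 : ∀ k, 0 ≤ a k := fun k =>
    mul_nonneg (by positivity) (le_min (abs_nonneg _) zero_le_one)
  have ha1 : ∀ k, a k ≤ (2:ℝ)⁻¹ ^ (k + 1) := fun k =>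
    mul_le_of_le_one_right (by positivity) (min_le_right _ _)
  have hsum : Summable a := Summable.of_nonneg_of_le ha0 ha1 hgeo.summable
  have hfin : ∑ k ∈ Finset.range K, a k ≤ η / 4 := by
    have h1 : ∑ k ∈ Finset.range K, a k ≤ ∑ k ∈ Finset.range K, (2:ℝ)⁻¹ ^ (k + 1) * (η / 4) :=
      Finset.sum_le_sum fun k hkK => mul_le_mul_of_nonneg_left
        ((min_le_left _ _).trans (hk k (Finset.mem_range.1 hkK)).1) (by positivity)
    rw [← Finset.sum_mul] at h1
    refine h1.trans (mul_le_of_le_one_left (by linarith) ?_)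
    exact sum_le_hasSum _ (fun k _ => by positivity) hgeo
  have htail : ∑' k, a (k + K) ≤ η / 4 := by
    have h1 : HasSum (fun k : ℕ => (2:ℝ)⁻¹ ^ K * (2:ℝ)⁻¹ ^ (k + 1)) ((2:ℝ)⁻¹ ^ K * 1) :=
      hgeo.mul_left _
    have h2 : ∑' k, a (k + K) ≤ ∑' k : ℕ, (2:ℝ)⁻¹ ^ K * (2:ℝ)⁻¹ ^ (k + 1) := by
      refine Summable.tsum_le_tsum (fun k => ?_) ((summable_nat_add_iff K).2 hsum) h1.summable
      refine (ha1 _).trans (le_of_eq ?_)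
      rw [← pow_add]; congr 1; ring
    rw [h1.tsum_eq, mul_one] at h2
    exact h2.trans hKp
  have := hsum.sum_add_tsum_nat_add K
  linarith

lemma abs_sub_le_of_abs_deriv_le {f : ℝ → ℝ} (hf : ContDiff ℝ 1 f) {C : ℝ}
    (hC : ∀ x, |deriv f x| ≤ C) {x y : ℝ} (hxy : x ≤ y) : |f x - f y| ≤ C * (y - x) := by
  have := Convex.norm_image_sub_le_of_norm_deriv_le (f := f) (s := univ) (x := y) (y := x)
    (fun z _ => (hf.differentiable one_ne_zero) z) (fun z _ => hC z) convex_univ trivial trivial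
  rwa [Real.norm_eq_abs, Real.norm_eq_abs, abs_sub_comm x y, abs_of_nonneg (sub_nonneg.2 hxy)]
    at this

section Convergence
variable {S : Setting} {L : ℝ} {ρ : ℕ → ℝ} {ζs : ℕ → ℝ → Measure ℝ} {𝒰 : Ultrafilter ℕ}
  {ζ : ℝ → Measure ℝ}

/-- Limits of good paths are equicontinuous against bounded Lipschitz test functions. -/
lemma Setting.limit_equicontinuous (hL : 1 < L) (hρ : Tendsto ρ atTop atTop)
    (hρ0 : ∀ i, 0 < ρ i) (hζ : ∀ i, S.memBLr L (ρ i) (ζs i)) (h𝒰 : (𝒰 : Filter ℕ) ≤ atTop)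
    {f : ℝ → ℝ} {B C : ℝ} (hB : ∀ x, 0 ≤ x → |f x| ≤ B)
    (hC : ∀ x y, 0 ≤ x → x ≤ y → |f x - f y| ≤ C * (y - x))
    (hlim : ∀ t ∈ Icc 0 L, Tendsto (fun i => pair f (ζs i t)) 𝒰 (nhds (pair f (ζ t))))
    {η : ℝ} (hη : 0 < η) :
    ∃ δ > 0, ∀ s ∈ Icc 0 L, ∀ t ∈ Icc 0 L, |s - t| < δ →
      |pair f (ζ s) - pair f (ζ t)| ≤ η := by
  obtain ⟨δ, hδ, h⟩ := S.equicontinuous hL hρ hρ0 hζ hB hC hη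
  refine ⟨δ, hδ, fun s hs t ht hst => ?_⟩
  refine le_of_tendsto ((hlim s hs).sub (hlim t ht)).abs ?_
  filter_upwards [h.filter_mono h𝒰] with i hi using hi s hs t ht hst

/-- Along an ultrafilter, good paths converge uniformly in time against bounded Lipschitz test
functions. -/
lemma Setting.eventually_abs_pair_sub_le (hL : 1 < L) (hρ : Tendsto ρ atTop atTop)
    (hρ0 : ∀ i, 0 < ρ i) (hζ : ∀ i, S.memBLr L (ρ i) (ζs i)) (h𝒰 : (𝒰 : Filter ℕ) ≤ atTop)
    {f : ℝ → ℝ} {B C : ℝ} (hB : ∀ x, 0 ≤ x → |f x| ≤ B)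
    (hC : ∀ x y, 0 ≤ x → x ≤ y → |f x - f y| ≤ C * (y - x))
    (hlim : ∀ t ∈ Icc 0 L, Tendsto (fun i => pair f (ζs i t)) 𝒰 (nhds (pair f (ζ t))))
    {η : ℝ} (hη : 0 < η) :
    ∀ᶠ i in (𝒰 : Filter ℕ), ∀ t ∈ Icc 0 L, |pair f (ζs i t) - pair f (ζ t)| ≤ η := by
  have hη3 : 0 < η / 3 := by linarith
  obtain ⟨δ₁, hδ₁, h₁⟩ := S.equicontinuous hL hρ hρ0 hζ hB hC hη3
  obtain ⟨δ₂, hδ₂, h₂⟩ := S.limit_equicontinuous hL hρ hρ0 hζ h𝒰 hB hC hlim hη3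
  obtain ⟨A, hA, hAfin, hcov⟩ := (isCompact_Icc (a := (0:ℝ)) (b := L)).finite_cover_balls
    (lt_min hδ₁ hδ₂)
  have h₃ : ∀ᶠ i in (𝒰 : Filter ℕ), ∀ s ∈ A, |pair f (ζs i s) - pair f (ζ s)| ≤ η / 3 := by
    rw [eventually_all_finite hAfin]
    intro s hs
    have := ((hlim s (hA hs)).sub_const (pair f (ζ s))).abs
    rw [sub_self, abs_zero] at this
    exact this.eventually (eventually_le_nhds hη3)
  filter_upwards [h₁.filter_mono h𝒰, h₃] with i hi₁ hi₃ t ht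
  obtain ⟨s, hs, hts⟩ := mem_iUnion₂.1 (hcov ht)
  rw [Metric.mem_ball, Real.dist_eq, lt_min_iff] at hts
  have a₁ := abs_le.1 (hi₁ t ht s (hA hs) hts.1)
  have a₂ := abs_le.1 (h₂ t ht s (hA hs) hts.2)
  have a₃ := abs_le.1 (hi₃ s hs)
  rw [abs_le]
  constructor <;> linarith [a₁.1, a₁.2, a₂.1, a₂.2, a₃.1, a₃.2]

end Convergence

/-- The excess over a high level is controlled by a higher moment. -/
lemma max_sub_zero_le_rpow {p K x : ℝ} (hp : 0 < p) (hK : 0 < K) (hx : 0 ≤ x) :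
    max (x - K) 0 ≤ (K ^ p)⁻¹ * x ^ (1 + p) := by
  have h0 : 0 < K ^ p := Real.rpow_pos_of_pos hK p
  refine max_le ?_ (mul_nonneg (inv_nonneg.2 h0.le) (Real.rpow_nonneg hx _))
  rcases le_total x K with h | h
  · exact (sub_nonpos.2 h).trans (mul_nonneg (inv_nonneg.2 h0.le) (Real.rpow_nonneg hx _))
  · rw [inv_mul_eq_div, le_div_iff₀ h0, Real.rpow_add (hK.trans_le h), Real.rpow_one]
    exact mul_le_mul (by linarith) (Real.rpow_le_rpow hK.le h hp.le) h0.le hx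

lemma abs_le_one_of_mem {f : ℝ → ℝ} (h : ∀ x, 0 ≤ f x ∧ f x ≤ 1) (x : ℝ) : |f x| ≤ 1 := by
  rw [abs_of_nonneg (h x).1]; exact (h x).2

/-- Sequences of good paths accumulate, in the metric and in workload, at elements of `B_L`. -/
lemma Setting.exists_accumulation (S : Setting) {L : ℝ} (hL : 1 < L) {j : ℕ → ℕ}
    {ζs : ℕ → ℝ → Measure ℝ} (hρ : Tendsto (fun i => S.R (j i)) atTop atTop)
    (hζ : ∀ i, S.memBLr L (S.R (j i)) (ζs i)) {η : ℝ} (hη : 0 < η) :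
    ∃ ζ, S.memBL L ζ ∧ ∃ i, ∀ t ∈ Icc 0 L, dmet S.gmet S.hmet (ζs i t) (ζ t) ≤ η ∧
      |pair id (ζs i t) - pair id (ζ t)| ≤ η := by
  have hρ0 : ∀ i, 0 < S.R (j i) := fun i => S.hR _
  have hM : 0 < S.M := zero_lt_one.trans S.hM
  have hmb : ∀ t ∈ Icc 0 L, ∀ i, MomentBound S.M S.p (ζs i t) := fun t ht i =>
    ((hζ i).bounds (hρ0 i) hL).1 t ht
  let 𝒰 : Ultrafilter ℕ := hyperfilter ℕ
  have h𝒰 : (𝒰 : Filter ℕ) ≤ atTop := Nat.hyperfilter_le_atTop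
  have hex : ∀ t ∈ Icc 0 L, ∃ ξ : Measure ℝ, IsFiniteMeasure ξ ∧ ∀ f : ℝ → ℝ, Continuous f →
      (∃ C, ∀ x, |f x| ≤ C) → Tendsto (fun i => pair f (ζs i t)) 𝒰 (nhds (pair f ξ)) :=
    fun t ht => exists_limit_of_momentBound 𝒰 hM.le (hmb t ht)
  choose! ζ hfin hlim using hex
  have hnull : ∀ t ∈ Icc 0 L, ζ t (Iio 0) = 0 := fun t ht =>
    have := hfin t ht
    limit_null (fun i => (hmb t ht i).null) (hlim t ht)
  have hid : ∀ t ∈ Icc 0 L, Integrable id (ζ t) ∧ pair id (ζ t) ≤ S.M := fun t ht =>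
    have := hfin t ht
    limit_integrable_le (hmb t ht) (hlim t ht) continuous_id (fun _ hx => hx)
      fun i => (hmb t ht i).first_le
  have hunif : ∀ f : ℝ → ℝ, Continuous f → ∀ B C : ℝ, (∀ x, |f x| ≤ B) →
      (∀ x y, x ≤ y → |f x - f y| ≤ C * (y - x)) → ∀ η > 0,
      ∀ᶠ i in (𝒰 : Filter ℕ), ∀ t ∈ Icc 0 L, |pair f (ζs i t) - pair f (ζ t)| ≤ η :=
    fun f hf B C hB hC η hη => S.eventually_abs_pair_sub_le hL hρ hρ0 hζ h𝒰 (fun x _ => hB x)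
      (fun x y _ => hC x y) (fun t ht => hlim t ht f hf ⟨B, hB⟩) hη
  have hcont : ∀ f : ℝ → ℝ, Continuous f → ∀ B C : ℝ, (∀ x, |f x| ≤ B) →
      (∀ x y, x ≤ y → |f x - f y| ≤ C * (y - x)) → ∀ η > 0,
      ∃ δ > 0, ∀ s ∈ Icc 0 L, ∀ t ∈ Icc 0 L, |s - t| < δ →
        |pair f (ζ s) - pair f (ζ t)| ≤ η :=
    fun f hf B C hB hC η hη => S.limit_equicontinuous hL hρ hρ0 hζ h𝒰 (fun x _ => hB x)
      (fun x y _ => hC x y) (fun t ht => hlim t ht f hf ⟨B, hB⟩) hη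
  have hfam := S.hmetfam
  have hg : ∀ k, ∃ C, ∀ x y, x ≤ y → |S.gmet k x - S.gmet k y| ≤ C * (y - x) := fun k => by
    obtain ⟨-, hd, C, hC⟩ := hfam.1 k
    exact ⟨C, fun x y => abs_sub_le_of_abs_deriv_le hd hC⟩
  choose Cg hCg using hg
  have hh : ∀ k, ∀ x y, x ≤ y → |S.hmet k x - S.hmet k y| ≤ 2 * (y - x) := fun k x y =>
    abs_sub_le_of_abs_deriv_le (hfam.2.1 k).2.1 (hfam.2.1 k).2.2.2.2
  have hd : ∀ η > 0, ∀ᶠ i in (𝒰 : Filter ℕ), ∀ t ∈ Icc 0 L,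
      dmet S.gmet S.hmet (ζs i t) (ζ t) ≤ η := by
    intro η hη
    obtain ⟨K, η', hη', hK⟩ := exists_dmet_le hfam S.M hη
    have h1 : ∀ k, ∀ᶠ i in (𝒰 : Filter ℕ), ∀ t ∈ Icc 0 L,
        |pair (S.gmet k) (ζs i t) - pair (S.gmet k) (ζ t)| ≤ η' ∧
        |pair (S.hmet k) (ζs i t) - pair (S.hmet k) (ζ t)| ≤ η' := fun k => by
      filter_upwards [hunif _ (hfam.1 k).2.1.continuous 1 (Cg k)
        (abs_le_one_of_mem (hfam.1 k).1) (hCg k) η' hη',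
        hunif _ (hfam.2.1 k).2.1.continuous 1 2 (abs_le_one_of_mem (hfam.2.1 k).1) (hh k) η' hη']
        with i h1 h2 t ht using ⟨h1 t ht, h2 t ht⟩
    have h2 := (eventually_all_finset (Finset.range K)).2 fun k _ => h1 k
    filter_upwards [h2] with i hi t ht
    exact hK _ _ (hmb t ht i).finite (hfin t ht) (hmb t ht i).null (hnull t ht)
      ((hmb t ht i).integrable _) (hid t ht).1 (hmb t ht i).first_le (hid t ht).2
      fun k hk => hi k (Finset.mem_range.2 hk) t ht
  have hdc : ∀ η > 0, ∃ δ > 0, ∀ s ∈ Icc 0 L, ∀ t ∈ Icc 0 L, |s - t| < δ →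
      dmet S.gmet S.hmet (ζ s) (ζ t) ≤ η := by
    intro η hη
    obtain ⟨K, η', hη', hK⟩ := exists_dmet_le hfam S.M hη
    choose δ₁ hδ₁ h₁ using fun k => hcont _ (hfam.1 k).2.1.continuous 1 (Cg k)
      (abs_le_one_of_mem (hfam.1 k).1) (hCg k) η' hη'
    choose δ₂ hδ₂ h₂ using fun k => hcont _ (hfam.2.1 k).2.1.continuous 1 2
      (abs_le_one_of_mem (hfam.2.1 k).1) (hh k) η' hη'
    have hev : ∀ᶠ δ in nhdsWithin (0:ℝ) (Ioi 0), ∀ k ∈ Finset.range K, δ < min (δ₁ k) (δ₂ k) :=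
      (eventually_all_finset _).2 fun k _ =>
        (eventually_lt_nhds (lt_min (hδ₁ k) (hδ₂ k))).filter_mono nhdsWithin_le_nhds
    obtain ⟨δ, hδ, hδ0⟩ := (hev.and self_mem_nhdsWithin).exists
    refine ⟨δ, hδ0, fun s hs t ht hst => ?_⟩
    refine hK _ _ (hfin s hs) (hfin t ht) (hnull s hs) (hnull t ht) (hid s hs).1 (hid t ht).1
      (hid s hs).2 (hid t ht).2 fun k hk => ?_
    have := lt_min_iff.1 (hst.trans (hδ k (Finset.mem_range.2 hk)))
    exact ⟨h₁ k s hs t ht this.1, h₂ k s hs t ht this.2⟩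
  have hw : ∀ η > 0, ∀ᶠ i in (𝒰 : Filter ℕ), ∀ t ∈ Icc 0 L,
      |pair id (ζs i t) - pair id (ζ t)| ≤ η := by
    intro η hη
    have hη2 : 0 < η / 2 := by linarith
    have htail : Tendsto (fun K : ℝ => (K ^ S.p)⁻¹ * S.M) atTop (nhds 0) := by
      simpa using (tendsto_rpow_atTop S.hp).inv_tendsto_atTop.mul_const S.M
    obtain ⟨K, hK, hK0⟩ := ((htail.eventually (eventually_le_nhds hη2)).and
      (eventually_gt_atTop 0)).exists
    let f : ℝ → ℝ := fun x => min (max x 0) K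
    let g : ℝ → ℝ := fun x => max (x - K) 0
    have hf : Continuous f := by fun_prop
    have hgc : Continuous g := by fun_prop
    have hfb : ∀ x, |f x| ≤ K := fun x => by
      rw [abs_of_nonneg (le_min (le_max_right _ _) hK0.le)]; exact min_le_right _ _
    have hfl : ∀ x y, x ≤ y → |f x - f y| ≤ 1 * (y - x) := fun x y hxy => by
      simp only [f]
      have h1 : max x 0 ≤ max y 0 := max_le_max_right _ hxy
      have h2 : max y 0 ≤ max x 0 + (y - x) :=
        max_le (by linarith [le_max_left x 0]) (by linarith [le_max_right x 0])
      have h3 : min (max x 0) K ≤ min (max y 0) K := min_le_min_right _ h1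
      have h4 : min (max y 0) K - (y - x) ≤ min (max x 0) K :=
        le_min (by linarith [min_le_left (max y 0) K]) (by linarith [min_le_right (max y 0) K])
      rw [abs_le]; constructor <;> linarith
    have hsplit : ∀ x, 0 ≤ x → id x = f x + g x := fun x hx => by
      simp only [f, g, id, max_eq_left hx]
      rcases le_total x K with h | h
      · rw [min_eq_left h, max_eq_right (by linarith)]; ring
      · rw [min_eq_right h, max_eq_left (by linarith)]; ring
    have hpair : ∀ ξ : Measure ℝ, IsFiniteMeasure ξ → ξ (Iio 0) = 0 → Integrable g ξ →
        pair id ξ = pair f ξ + pair g ξ := fun ξ _ hn hi => by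
      have hfi : Integrable f ξ := Integrable.of_bound hf.aestronglyMeasurable K
        (Eventually.of_forall hfb)
      refine Eq.trans (integral_congr_ae ?_) (integral_add hfi hi)
      filter_upwards [ae_nonneg_of_null hn] with x hx using hsplit x hx
    have hgs : ∀ t ∈ Icc 0 L, ∀ i, pair g (ζs i t) ≤ η / 2 := fun t ht i => by
      have hb := hmb t ht i
      refine le_trans ?_ hK
      refine le_trans ?_ (mul_le_mul_of_nonneg_left hb.moment_le
        (inv_nonneg.2 (Real.rpow_nonneg hK0.le _)))
      refine le_trans (pair_le_pair hb.null (hb.integrable _) (hb.integrable _)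
        fun x hx => max_sub_zero_le_rpow S.hp hK0 hx) (le_of_eq (integral_const_mul _ _))
    have hg0 : ∀ ξ : Measure ℝ, 0 ≤ pair g ξ := fun ξ => integral_nonneg fun x => le_max_right _ _
    filter_upwards [hunif f hf K 1 hfb hfl (η / 2) hη2] with i hi t ht
    have hb := hmb t ht i
    have := hfin t ht
    have hgl := limit_integrable_le (hmb t ht) (hlim t ht) hgc (fun x _ => le_max_right _ _)
      (hgs t ht)
    rw [hpair _ hb.finite hb.null (hb.integrable _), hpair _ this (hnull t ht) hgl.1]
    have a := abs_le.1 (hi t ht)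
    rw [abs_le]
    constructor <;> linarith [a.1, a.2, hg0 (ζs i t), hg0 (ζ t), hgs t ht i, hgl.2]
  refine ⟨ζ, ⟨fun t ht => ⟨hfin t ht, hnull t ht⟩, fun t ht ε hε => ?_, ?_⟩, ?_⟩
  · obtain ⟨δ, hδ, h⟩ := hdc (ε / 2) (by linarith)
    exact ⟨δ, hδ, fun s hs hst => (h s hs t ht hst).trans_lt (by linarith)⟩
  · obtain ⟨φ, hφ, hφd⟩ := extraction_forall_of_frequently
      (P := fun n i => ∀ t ∈ Icc 0 L, dmet S.gmet S.hmet (ζs i t) (ζ t) ≤ 1 / ((n:ℝ) + 1))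
      fun n => (hd _ (by positivity)).frequently.filter_mono h𝒰
    have hj : Tendsto (fun i => j (φ i)) atTop atTop := by
      have hRj := hρ.comp hφ.tendsto_atTop
      refine tendsto_atTop.2 fun b => ?_
      filter_upwards [hRj.eventually (eventually_ge_atTop (S.R b))] with i hi
      exact S.hRmono.le_iff_le.1 hi
    obtain ⟨ψ, hψ, hjψ⟩ := strictMono_subseq_of_tendsto_atTop hj
    refine ⟨_, fun i => ζs (φ (ψ i)), hjψ, fun i => hζ _, fun ε hε => ?_⟩
    obtain ⟨J, hJ⟩ := exists_nat_one_div_lt hε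
    refine ⟨J, fun i hi t ht => (hφd (ψ i) t ht).trans (le_trans ?_ hJ.le)⟩
    have : (J:ℝ) ≤ ψ i := Nat.cast_le.2 (hi.trans (hψ.le_apply))
    exact one_div_le_one_div_of_le (by positivity) (by linarith)
  · obtain ⟨i, hi⟩ := ((hd η hη).and (hw η hη)).exists
    exact ⟨i, fun t ht => ⟨hi.1 t ht, hi.2 t ht⟩⟩

end PSQ

open PSQ MeasureTheory in
/-- Lemma 4.4: for large r ∈ R, every good path in B_L^r is uniformly
ε_n-close (in the metric d, and in workload) to some element of B_L. -/
theorem stmt_13 (S : PSQ.Setting) (L : ℝ) (hL : 1 < L) :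
    ∀ n : ℕ, ∃ r'n : ℝ, S.rseq n < r'n ∧
      ∀ j : ℕ, r'n < S.R j →
        ∀ ζr : ℝ → Measure ℝ, S.memBLr L (S.R j) ζr →
          ∃ ζ : ℝ → Measure ℝ, S.memBL L ζ ∧
            (∀ t ∈ Set.Icc (0:ℝ) L, dmet S.gmet S.hmet (ζr t) (ζ t) ≤ S.εseq n) ∧
            (∀ t ∈ Set.Icc (0:ℝ) L, |pair id (ζr t) - pair id (ζ t)| ≤ S.εseq n) := by
  intro n
  by_contra! hcon
  choose j hj ζs hζ hbad using fun i : ℕ =>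
    hcon (S.rseq n + i + 1) (by linarith [(Nat.cast_nonneg i : (0:ℝ) ≤ i)])
  have hρ : Tendsto (fun i => S.R (j i)) atTop atTop := by
    refine tendsto_atTop_mono (fun i => ?_) tendsto_natCast_atTop_atTop
    linarith [hj i, S.hrpos n]
  obtain ⟨ζ, hmem, i, hi⟩ := S.exists_accumulation hL hρ hζ (S.hε n).1
  obtain ⟨t, ht, hlt⟩ := hbad i ζ hmem fun t ht => (hi t ht).1
  exact absurd (hi t ht).2 (not_le.2 hlt)
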